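/- arXiv:1305.5365 — 2 statements merged into one kernel-verified Lean document; each statement's English description precedes it below -/
import Mathlib

section
/- Let (T(t))_{t≥0} be a bounded C₀-semigroup on a complex Hilbert space X with generator −A. Assume that σ(A) ∩ iℝ = {0} and that ‖(is+A)^{-1}‖ = O( 1/(|s|^α ℓ(1/|s|)) ) as s → 0 and ‖(is+A)^{-1}‖ = O(1) as |s| → ∞, where α > 1 and ℓ is an increasing slowly varying function. Then ‖T(t)A(I+A)^{-1}‖ = O( (t · ℓ(t^{1/α}))^{-1/α} ) as t → ∞. -/
open Filter MeasureTheory Set Complex Asymptotics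

noncomputable section

/-- A `C₀`-semigroup of bounded linear operators on `X`:  a strongly continuous family
`(T t)_{t ≥ 0}` with `T 0 = 1` and `T (s+t) = T s ∘ T t`. -/
structure C0Semigroup (X : Type*) [NormedAddCommGroup X] [NormedSpace ℂ X] where
  T : ℝ → X →L[ℂ] X
  map_zero : T 0 = 1
  map_add : ∀ s t : ℝ, 0 ≤ s → 0 ≤ t → T (s + t) = T s ∘L T t
  strong_continuity : ∀ x : X, ContinuousOn (fun t : ℝ => T t x) (Set.Ici 0)

/-- A `C₀`-semigroup is bounded if `sup_{t ≥ 0} ‖T t‖ < ∞`. -/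
def C0Semigroup.Bounded {X : Type*} [NormedAddCommGroup X] [NormedSpace ℂ X]
    (Tsg : C0Semigroup X) : Prop :=
  ∃ K : ℝ, ∀ t : ℝ, 0 ≤ t → ‖Tsg.T t‖ ≤ K

/-- `R` is the bounded inverse `(lam + A)⁻¹` of `lam + A`, where `A` is a partially
defined linear operator on `X`. -/
structure IsResolvent {X : Type*} [NormedAddCommGroup X] [NormedSpace ℂ X]
    (A : X →ₗ.[ℂ] X) (lam : ℂ) (R : X →L[ℂ] X) : Prop where
  mem_domain : ∀ x : X, R x ∈ A.domain
  eq_apply : ∀ x : X, lam • R x + A ⟨R x, mem_domain x⟩ = x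
  left_inv : ∀ x : A.domain, R (lam • (x : X) + A x) = x

/-- `-A` is the generator of the `C₀`-semigroup `Tsg`:  the domain of `A` is exactly the
set of points `x` for which the right derivative of the orbit `t ↦ T t x` exists at `0`,
and there `A x` equals minus that derivative. -/
def IsGenerator {X : Type*} [NormedAddCommGroup X] [NormedSpace ℂ X]
    (Tsg : C0Semigroup X) (A : X →ₗ.[ℂ] X) : Prop :=
  ∀ x y : X,
    (∃ hx : x ∈ A.domain, A ⟨x, hx⟩ = y) ↔
      Filter.Tendsto (fun t : ℝ => (t : ℂ)⁻¹ • (Tsg.T t x - x))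
        (nhdsWithin 0 (Set.Ioi 0)) (nhds (-y))

/-- A positive measurable function `l` is slowly varying if `l (lam * s) / l s → 1`
as `s → ∞`, for every `lam > 0`. -/
def SlowlyVarying (l : ℝ → ℝ) : Prop :=
  Measurable l ∧ (∀ᶠ s in atTop, 0 < l s) ∧
    ∀ lam : ℝ, 0 < lam → Tendsto (fun s : ℝ => l (lam * s) / l s) atTop (nhds 1)

/-- `ls` is a de Bruijn conjugate of the slowly varying function `l`. -/
def IsDeBruijnConjugate (l ls : ℝ → ℝ) : Prop :=
  SlowlyVarying ls ∧
    Tendsto (fun s : ℝ => l s * ls (s * l s)) atTop (nhds 1) ∧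
    Tendsto (fun s : ℝ => ls s * l (s * ls s)) atTop (nhds 1)

/-- A monotonic slowly varying function `l` is dB-symmetric when `1 / l` is a
de Bruijn conjugate of `l`. -/
def DBSymmetric (l : ℝ → ℝ) : Prop := IsDeBruijnConjugate l fun s => (l s)⁻¹

/-- `g` is an asymptotic inverse of `f`:  `g (f s) ∼ s` and `f (g s) ∼ s` as `s → ∞`. -/
def IsAsympInverse (g f : ℝ → ℝ) : Prop :=
  Tendsto (fun s : ℝ => g (f s) / s) atTop (nhds 1) ∧
    Tendsto (fun s : ℝ => f (g s) / s) atTop (nhds 1)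

/-- The Balakrishnan integral defining the fractional power `B ^ γ` (`0 < γ < 1`) of a
bounded sectorial operator `B`. -/
def balakrishnan {X : Type*} [NormedAddCommGroup X] [NormedSpace ℂ X] [CompleteSpace X]
    (B : X →L[ℂ] X) (γ : ℝ) : X →L[ℂ] X :=
  (Real.sin (Real.pi * γ) / Real.pi) •
    ∫ t in Set.Ioi (0 : ℝ),
      (t ^ (γ - 1) : ℝ) • (B * Ring.inverse ((t : ℂ) • (1 : X →L[ℂ] X) + B))

/-- The fractional power `B ^ α`, `α ≥ 0`, of a bounded sectorial operator `B`, obtained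
from integer powers and the Balakrishnan formula for the fractional part. -/
def opPow {X : Type*} [NormedAddCommGroup X] [NormedSpace ℂ X] [CompleteSpace X]
    (B : X →L[ℂ] X) (α : ℝ) : X →L[ℂ] X :=
  if α = (⌊α⌋₊ : ℝ) then B ^ (⌊α⌋₊ : ℕ) else B ^ (⌊α⌋₊ : ℕ) * balakrishnan B (α - ⌊α⌋₊)

end

section Plancherel
open FourierTransform SchwartzMap
open scoped ContDiff

theorem aux_plancherel {X : Type*} [NormedAddCommGroup X] [InnerProductSpace ℂ X] [CompleteSpace X]
    (f : ℝ → X) (hf : Integrable f) (hf2 : MemLp f 2) :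
    eLpNorm (𝓕 f) 2 volume = eLpNorm f 2 volume := by
  set F : Lp X 2 (volume : Measure ℝ) := hf2.toLp f with hF
  have hcont : Continuous (𝓕 f) :=
    VectorFourier.fourierIntegral_continuous Real.continuous_fourierChar
      (L := innerₗ ℝ) continuous_inner hf
  have hae : ∀ᵐ x : ℝ, (𝓕 F : Lp X 2 (volume : Measure ℝ)) x = 𝓕 f x := by
    apply ae_eq_of_integral_contDiff_smul_eq
    · exact (Lp.memLp _).locallyIntegrable (by norm_num)
    · exact hcont.locallyIntegrable
    · intro g g_smooth g_cpt
      have hg₁ : HasCompactSupport (Complex.ofRealCLM ∘ g) := g_cpt.comp_left rfl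
      have hg₂ : ContDiff ℝ ∞ (Complex.ofRealCLM ∘ g) := by fun_prop
      set φ : 𝓢(ℝ, ℂ) := hg₁.toSchwartzMap hg₂ with hφ
      have e1 : Lp.toTemperedDistribution (𝓕 F : Lp X 2 (volume : Measure ℝ)) φ
          = Lp.toTemperedDistribution F (𝓕 φ) := by
        rw [← Lp.fourier_toTemperedDistribution_eq, TemperedDistribution.fourier_apply]
      rw [Lp.toTemperedDistribution_apply, Lp.toTemperedDistribution_apply] at e1
      have e2 : ∫ x, (𝓕 φ) x • F x = ∫ x, (𝓕 φ) x • f x := by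
        apply integral_congr_ae
        filter_upwards [hf2.coeFn_toLp] with x hx
        rw [hF, hx]
      have e3 : ∫ x, (𝓕 φ) x • f x = ∫ x, φ x • 𝓕 f x := by
        rw [SchwartzMap.fourier_coe]
        simpa using! (VectorFourier.integral_fourierIntegral_smul_eq_flip (L := innerₗ ℝ)
          Real.continuous_fourierChar continuous_inner φ.integrable hf)
      rw [e2, e3] at e1
      simpa [hφ] using e1
  calc eLpNorm (𝓕 f) 2 volume = eLpNorm (𝓕 F : Lp X 2 (volume : Measure ℝ)) 2 volume :=
        (eLpNorm_congr_ae hae).symm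
    _ = eLpNorm F 2 volume := by
        have h := Lp.norm_fourier_eq F
        rw [Lp.norm_def, Lp.norm_def] at h
        exact (ENNReal.toReal_eq_toReal_iff' (Lp.memLp _).2.ne (Lp.memLp _).2.ne).1 h
    _ = eLpNorm f 2 volume := eLpNorm_congr_ae hf2.coeFn_toLp
end Plancherel
section Laplace
open Topology

variable {X : Type*} [NormedAddCommGroup X] [NormedSpace ℂ X]

theorem aux_norm_exp (lam : ℂ) (t : ℝ) : ‖cexp (-lam * t)‖ = Real.exp (-lam.re * t) := by
  rw [Complex.norm_exp]; simp

theorem aux_contOn (Tsg : C0Semigroup X) (lam : ℂ) (x : X) :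
    ContinuousOn (fun t : ℝ => cexp (-lam * t) • Tsg.T t x) (Ici 0) := by
  apply ContinuousOn.smul
  · fun_prop
  · exact Tsg.strong_continuity x

theorem aux_norm_le (Tsg : C0Semigroup X) (K : ℝ)
    (hK : ∀ t : ℝ, 0 ≤ t → ‖Tsg.T t‖ ≤ K) (lam : ℂ) (x : X) (t : ℝ) (ht : 0 ≤ t) :
    ‖cexp (-lam * t) • Tsg.T t x‖ ≤ K * ‖x‖ * Real.exp (-lam.re * t) := by
  rw [norm_smul, aux_norm_exp, mul_comm]
  gcongr
  exact (Tsg.T t).le_of_opNorm_le (hK t ht) x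

theorem aux_integrable (Tsg : C0Semigroup X) (K : ℝ)
    (hK : ∀ t : ℝ, 0 ≤ t → ‖Tsg.T t‖ ≤ K) (lam : ℂ) (hl : 0 < lam.re) (x : X) :
    IntegrableOn (fun t : ℝ => cexp (-lam * t) • Tsg.T t x) (Ioi 0) := by
  have h1 : IntegrableOn (fun t : ℝ => K * ‖x‖ * Real.exp (-lam.re * t)) (Ioi 0) :=
    (integrableOn_exp_mul_Ioi (by linarith) 0).const_mul _
  refine Integrable.mono' h1 ?_ ?_
  · exact ((aux_contOn Tsg lam x).mono Ioi_subset_Ici_self).aestronglyMeasurable measurableSet_Ioi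
  · refine (ae_restrict_iff' measurableSet_Ioi).2 (Eventually.of_forall fun t ht => ?_)
    exact aux_norm_le Tsg K hK lam x t (le_of_lt ht)

theorem aux_shift_Ioi {E : Type*} [NormedAddCommGroup E] [NormedSpace ℝ E] (f : ℝ → E) (h : ℝ) :
    ∫ t in Ioi (0 : ℝ), f (t + h) = ∫ t in Ioi h, f t := by
  have := (measurePreserving_add_right (volume : Measure ℝ) h).setIntegral_preimage_emb
    (measurableEmbedding_addRight h) f (Ioi h)
  simpa using this

theorem aux_T_comm (Tsg : C0Semigroup X) {s t : ℝ} (hs : 0 ≤ s) (ht : 0 ≤ t) (x : X) :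
    Tsg.T s (Tsg.T t x) = Tsg.T (t + s) x := by
  rw [add_comm, Tsg.map_add s t hs ht]; rfl

theorem aux_lap_resolvent [CompleteSpace X] (Tsg : C0Semigroup X) (K : ℝ)
    (hK : ∀ t : ℝ, 0 ≤ t → ‖Tsg.T t‖ ≤ K) (A : X →ₗ.[ℂ] X) (hgen : IsGenerator Tsg A)
    (lam : ℂ) (hl : 0 < lam.re) :
    ∃ G : X →L[ℂ] X, IsResolvent A lam G ∧ ‖G‖ ≤ K / lam.re ∧
      (∀ x, G x = ∫ t in Ioi (0 : ℝ), cexp (-lam * t) • Tsg.T t x) ∧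
      (∀ t : ℝ, 0 ≤ t → G ∘L Tsg.T t = Tsg.T t ∘L G) := by
  have hK0 : 0 ≤ K := (norm_nonneg _).trans (hK 0 le_rfl)
  have hint := aux_integrable Tsg K hK lam hl
  let G0 : X →ₗ[ℂ] X :=
    { toFun := fun x => ∫ t in Ioi (0 : ℝ), cexp (-lam * t) • Tsg.T t x
      map_add' := by
        intro x y
        rw [← integral_add (hint x) (hint y)]
        simp only [map_add, smul_add]
      map_smul' := by
        intro c x
        simp only [RingHom.id_apply]
        rw [← integral_smul]
        simp only [map_smul, smul_comm c] }
  have hb : ∀ x, ‖G0 x‖ ≤ K / lam.re * ‖x‖ := by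
    intro x
    have h1 : IntegrableOn (fun t : ℝ => K * ‖x‖ * Real.exp (-lam.re * t)) (Ioi 0) :=
      (integrableOn_exp_mul_Ioi (by linarith) 0).const_mul _
    calc ‖G0 x‖ ≤ ∫ t in Ioi (0 : ℝ), K * ‖x‖ * Real.exp (-lam.re * t) := by
          refine norm_integral_le_of_norm_le h1 ?_
          refine (ae_restrict_iff' measurableSet_Ioi).2 (Eventually.of_forall fun t ht => ?_)
          exact aux_norm_le Tsg K hK lam x t (le_of_lt ht)
      _ = K / lam.re * ‖x‖ := by
          rw [integral_const_mul, integral_exp_mul_Ioi (by linarith)]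
          simp
          field_simp
  let G : X →L[ℂ] X := G0.mkContinuous _ hb
  have hG : ∀ x, G x = ∫ t in Ioi (0 : ℝ), cexp (-lam * t) • Tsg.T t x := fun x => rfl
  have hcomm : ∀ t : ℝ, 0 ≤ t → G ∘L Tsg.T t = Tsg.T t ∘L G := by
    intro s hs
    ext x
    simp only [ContinuousLinearMap.comp_apply]
    rw [hG, hG, ← ContinuousLinearMap.integral_comp_comm _ (hint x)]
    refine setIntegral_congr_fun measurableSet_Ioi fun t ht => ?_
    have ht' : (0 : ℝ) ≤ t := le_of_lt ht
    simp only [map_smul]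
    rw [aux_T_comm Tsg hs ht', aux_T_comm Tsg ht' hs, add_comm]
  -- the shift identity
  have hshift : ∀ x, ∀ h : ℝ, 0 ≤ h → Tsg.T h (G x) =
      cexp (lam * h) • (G x - ∫ t in (0 : ℝ)..h, cexp (-lam * t) • Tsg.T t x) := by
    intro x h hh
    have e1 : Tsg.T h (G x) = ∫ t in Ioi (0 : ℝ),
        cexp (lam * h) • (fun t : ℝ => cexp (-lam * t) • Tsg.T t x) (t + h) := by
      rw [hG, ← ContinuousLinearMap.integral_comp_comm _ (hint x)]
      refine setIntegral_congr_fun measurableSet_Ioi fun t ht => ?_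
      have ht' : (0 : ℝ) ≤ t := le_of_lt ht
      simp only [map_smul]
      rw [aux_T_comm Tsg hh ht', smul_smul, ← Complex.exp_add]
      congr 2
      push_cast; ring
    rw [e1, integral_smul, aux_shift_Ioi (fun t : ℝ => cexp (-lam * t) • Tsg.T t x)]
    congr 1
    rw [hG, intervalIntegral.integral_of_le hh, eq_sub_iff_add_eq, add_comm,
      ← setIntegral_union Ioc_disjoint_Ioi_same measurableSet_Ioi
      ((hint x).mono_set Ioc_subset_Ioi_self) ((hint x).mono_set (Ioi_subset_Ioi hh)),
      Ioc_union_Ioi_eq_Ioi hh]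
  have hlim : ∀ x, Filter.Tendsto (fun t : ℝ => (t : ℂ)⁻¹ • (Tsg.T t (G x) - G x))
        (nhdsWithin 0 (Set.Ioi 0)) (nhds (lam • G x - x)) := by
    intro x
    have hc := aux_contOn Tsg lam x
    have d1 : HasDerivWithinAt (fun h : ℝ => ∫ t in (0 : ℝ)..h, cexp (-lam * t) • Tsg.T t x)
        (cexp (-lam * (0 : ℝ)) • Tsg.T 0 x) (Ici 0) 0 := by
      apply intervalIntegral.integral_hasDerivWithinAt_right
      · simp
      · exact ⟨Ioi 0, self_mem_nhdsWithin,
          (hc.mono Ioi_subset_Ici_self).aestronglyMeasurable measurableSet_Ioi⟩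
      · exact (hc 0 self_mem_Ici).mono Ioi_subset_Ici_self
    have d2 : HasDerivWithinAt (fun h : ℝ => cexp (lam * h)) lam (Ici 0) 0 := by
      have : HasDerivAt (fun h : ℂ => cexp (lam * h)) (cexp (lam * 0) * (lam * 1)) ((0 : ℝ) : ℂ) := by
        have h1 := ((hasDerivAt_id (((0 : ℝ) : ℂ))).const_mul lam).cexp
        simpa using h1
      have h2 := this.comp_ofReal
      simp only [mul_zero, Complex.exp_zero, mul_one, one_mul] at h2
      exact h2.hasDerivWithinAt
    have d3 := d2.smul ((hasDerivWithinAt_const (0 : ℝ) (Ici 0) (G x)).sub d1)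
    have d4 : HasDerivWithinAt (fun h : ℝ => Tsg.T h (G x)) (lam • G x - x) (Ici 0) 0 := by
      refine (d3.congr_of_mem (fun h hh => hshift x h hh) self_mem_Ici).congr_deriv ?_
      simp [Tsg.map_zero, sub_eq_add_neg, add_comm]
    have d5 := (hasDerivWithinAt_iff_tendsto_slope' (by simp)).1
      (d4.mono Ioi_subset_Ici_self)
    refine d5.congr fun t => ?_
    rw [slope_def_module, Tsg.map_zero, sub_zero, ← Complex.ofReal_inv, Complex.coe_smul]
    rfl
  have hgenG : ∀ x, ∃ hx : G x ∈ A.domain, A ⟨G x, hx⟩ = x - lam • G x := by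
    intro x
    rw [hgen]
    simpa using hlim x
  refine ⟨G, ⟨fun x => (hgenG x).1, fun x => ?_, fun z => ?_⟩, ?_, hG, hcomm⟩
  · rw [(hgenG x).2]; abel
  · have h1 := (hgen z (A z)).1 ⟨z.2, rfl⟩
    have h2 := (G.continuous.tendsto _).comp h1
    have h3 := hlim z
    have h4 : Tendsto (fun t : ℝ => (t : ℂ)⁻¹ • (Tsg.T t (G z) - G z))
        (nhdsWithin 0 (Set.Ioi 0)) (nhds (G (-(A z)))) := by
      refine h2.congr' ?_
      filter_upwards [self_mem_nhdsWithin] with t ht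
      have := congrArg (fun F : X →L[ℂ] X => F z) (hcomm t (le_of_lt ht))
      simp only [ContinuousLinearMap.comp_apply] at this
      simp [this]
    have h5 := tendsto_nhds_unique h3 h4
    rw [map_add, map_smul]
    rw [map_neg] at h5
    have : G (A z) = - (lam • G z - z) := by rw [h5, neg_neg]
    rw [this]; abel
  · exact G0.mkContinuous_norm_le (by positivity) hb

end Laplace
section ResolventAlgebra

variable {X : Type*} [NormedAddCommGroup X] [NormedSpace ℂ X]

theorem aux_res_ident {A : X →ₗ.[ℂ] X} {lam mu : ℂ} {R S : X →L[ℂ] X}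
    (hR : IsResolvent A lam R) (hS : IsResolvent A mu S) :
    R - S = (mu - lam) • (R * S) := by
  ext x
  have h1 := hR.left_inv ⟨S x, hS.mem_domain x⟩
  have h2 := hS.eq_apply x
  have h3 : A ⟨S x, hS.mem_domain x⟩ = x - mu • S x := eq_sub_of_add_eq' h2
  rw [h3] at h1
  simp only [map_add, map_sub, map_smul] at h1
  have h4 : R x - S x = mu • R (S x) - lam • R (S x) := by
    have h5 : R x - S x = R x - (lam • R (S x) + (R x - mu • R (S x))) := by rw [h1]
    rw [h5]; abel
  simpa [sub_smul] using h4

theorem aux_res_unique {A : X →ₗ.[ℂ] X} {lam : ℂ} {R S : X →L[ℂ] X}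
    (hR : IsResolvent A lam R) (hS : IsResolvent A lam S) : R = S := by
  have := aux_res_ident hR hS
  simpa [sub_eq_zero] using this

theorem aux_res_comm {A : X →ₗ.[ℂ] X} {lam mu : ℂ} {R S : X →L[ℂ] X}
    (hR : IsResolvent A lam R) (hS : IsResolvent A mu S) : Commute R S := by
  by_cases h : lam = mu
  · subst h
    rw [aux_res_unique hR hS]
  · have h1 := aux_res_ident hR hS
    have h2 := aux_res_ident hS hR
    have h3 : (mu - lam) • (R * S) = (mu - lam) • (S * R) := by
      rw [← h1, ← neg_sub S R, h2, ← neg_smul, neg_sub]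
    exact smul_right_injective _ (sub_ne_zero.2 (Ne.symm h)) h3

theorem aux_coef (K : ℝ) (hK : 0 ≤ K) (n : ℕ) : ∃ c : ℝ, 0 ≤ c ∧
    ∀ (R G : X →L[ℂ] X) (z : ℂ) (e : ℝ), 0 < e → ‖z‖ ≤ e → Commute R G →
      R - G = ((e : ℂ) - z) • (R * G) → ‖G‖ ≤ K / e → ‖1 - (e : ℂ) • G‖ ≤ 1 + K →
      ‖R * (1 - (e : ℂ) • G) ^ n‖ ≤ c * (1 / e + (‖z‖ / e) ^ n * ‖R‖) := by
  induction n with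
  | zero =>
    refine ⟨1, zero_le_one, fun R G z e he _ _ _ _ _ => ?_⟩
    simp; positivity
  | succ k ih =>
    obtain ⟨c, hc, ih⟩ := ih
    refine ⟨K * (1 + K) ^ k + K * c, by positivity, fun R G z e he hz hcm hRG hG hP => ?_⟩
    have hk := ih R G z e he hz hcm hRG hG hP
    set P := (1 - (e : ℂ) • G) with hPdef
    have hRP : R * P = G - z • (G * R) := by
      rw [hPdef, mul_sub, mul_one, mul_smul_comm, ← hcm.eq]
      rw [sub_smul] at hRG
      have : (e : ℂ) • (R * G) = R - G + z • (R * G) := by rw [hRG]; abel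
      rw [this]; abel
    have e1 : R * P ^ (k + 1) = G * P ^ k - z • (G * (R * P ^ k)) := by
      rw [pow_succ', ← mul_assoc, hRP, sub_mul, smul_mul_assoc, mul_assoc]
    have hPk : ‖P ^ k‖ ≤ (1 + K) ^ k := by
      rcases Nat.eq_zero_or_pos k with h | h
      · subst h
        rw [pow_zero, pow_zero]; exact ContinuousLinearMap.norm_id_le
      · exact (norm_pow_le' P h).trans (pow_le_pow_left₀ (norm_nonneg _) hP k)
    have hq : ‖z‖ / e ≤ 1 := (div_le_one he).2 hz
    rw [e1]
    calc ‖G * P ^ k - z • (G * (R * P ^ k))‖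
        ≤ ‖G * P ^ k‖ + ‖z • (G * (R * P ^ k))‖ := norm_sub_le _ _
      _ ≤ K / e * (1 + K) ^ k + ‖z‖ * (K / e * (c * (1 / e + (‖z‖ / e) ^ k * ‖R‖))) := by
          rw [norm_smul]
          gcongr
          · exact (norm_mul_le _ _).trans (by gcongr)
          · exact (norm_mul_le _ _).trans (by gcongr)
      _ = K * (1 + K) ^ k * (1 / e) + K * c * ((‖z‖ / e) * (1 / e) + (‖z‖ / e) ^ (k + 1) * ‖R‖) := by
          rw [pow_succ]; field_simp
      _ ≤ K * (1 + K) ^ k * (1 / e + (‖z‖ / e) ^ (k + 1) * ‖R‖) +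
            K * c * (1 * (1 / e) + (‖z‖ / e) ^ (k + 1) * ‖R‖) := by
          gcongr
          have : 0 ≤ (‖z‖ / e) ^ (k + 1) * ‖R‖ := by positivity
          linarith
      _ = _ := by ring

theorem aux_pow_norm (K : ℝ) (hK : 0 ≤ K) (P : X →L[ℂ] X) (hP : ‖P‖ ≤ 1 + K) (k : ℕ) :
    ‖P ^ k‖ ≤ (1 + K) ^ k := by
  rcases Nat.eq_zero_or_pos k with h | h
  · subst h
    rw [pow_zero, pow_zero]; exact ContinuousLinearMap.norm_id_le
  · exact (norm_pow_le' P h).trans (pow_le_pow_left₀ (norm_nonneg _) hP k)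

theorem aux_one_sub_norm (K : ℝ) (F : X →L[ℂ] X) (hF : ‖F‖ ≤ K) : ‖1 - F‖ ≤ 1 + K :=
  (norm_sub_le _ _).trans (add_le_add ContinuousLinearMap.norm_id_le hF)

/-- Estimates for `R (1 - J) P ^ n`. -/
theorem aux_RQ (K : ℝ) (hK : 0 ≤ K) (n : ℕ) : ∃ c : ℝ, 0 ≤ c ∧
    ∀ (R G J : X →L[ℂ] X) (z : ℂ) (e : ℝ), 0 < e → Commute R G → Commute R J →
      R - G = ((e : ℂ) - z) • (R * G) → R - J = (1 - z) • (R * J) →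
      ‖G‖ ≤ K / e → ‖J‖ ≤ K →
      ‖R * ((1 - J) * (1 - (e : ℂ) • G) ^ n)‖ ≤ c * ‖R‖ ∧
      ‖R * ((1 - J) * (1 - (e : ℂ) • G) ^ n)‖ ≤ c * (1 + ‖z‖ * ‖R‖) ∧
      (‖z‖ ≤ e → ‖R * ((1 - J) * (1 - (e : ℂ) • G) ^ n)‖ ≤
        c * (1 + ‖z‖ * ((‖z‖ / e) ^ n * ‖R‖))) := by
  obtain ⟨c, hc, hcoef⟩ := aux_coef (X := X) K hK n
  refine ⟨(1 + K) * (1 + K) ^ n + K * (1 + K) ^ n + K * c, by positivity,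
    fun R G J z e he hRG hRJ iG iJ hG hJ => ?_⟩
  have heG : ‖(e : ℂ) • G‖ ≤ K := by
    rw [norm_smul, Complex.norm_real, Real.norm_of_nonneg he.le]
    calc e * ‖G‖ ≤ e * (K / e) := by gcongr
      _ = K := by field_simp
  have hP := aux_one_sub_norm K _ heG
  set P := (1 - (e : ℂ) • G) with hPdef
  have hB := aux_one_sub_norm K _ hJ
  have hPn := aux_pow_norm K hK P hP n
  have hRB : R * (1 - J) = J - z • (J * R) := by
    rw [mul_sub, mul_one, ← hRJ.eq]
    rw [sub_smul, one_smul] at iJ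
    have : (R * J) = R - J + z • (R * J) := by rw [iJ]; abel
    nth_rewrite 1 [this]; abel
  have e1 : R * ((1 - J) * P ^ n) = J * P ^ n - z • (J * (R * P ^ n)) := by
    rw [← mul_assoc, hRB, sub_mul, smul_mul_assoc, mul_assoc]
  have hn1 : ‖R * ((1 - J) * P ^ n)‖ ≤ K * (1 + K) ^ n + ‖z‖ * (K * ‖R * P ^ n‖) := by
    rw [e1]
    refine (norm_sub_le _ _).trans ?_
    rw [norm_smul]
    gcongr
    · exact (norm_mul_le _ _).trans (by gcongr)
    · exact (norm_mul_le _ _).trans (by gcongr)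
  have hRPn : ‖R * P ^ n‖ ≤ ‖R‖ * (1 + K) ^ n := (norm_mul_le _ _).trans (by gcongr)
  have q1 : 0 ≤ K * c := by positivity
  have q2 : 0 ≤ K * (1 + K) ^ n := by positivity
  have q3 : 0 ≤ (1 + K) * (1 + K) ^ n := by positivity
  refine ⟨?_, ?_, fun hz => ?_⟩
  · calc ‖R * ((1 - J) * P ^ n)‖ ≤ ‖R‖ * ((1 + K) * (1 + K) ^ n) := by
          refine (norm_mul_le _ _).trans ?_
          gcongr
          exact (norm_mul_le _ _).trans (by gcongr)
      _ ≤ _ := by nlinarith [norm_nonneg R]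
  · refine hn1.trans ?_
    have h0 : 0 ≤ ‖z‖ * ‖R‖ := by positivity
    have : ‖z‖ * (K * ‖R * P ^ n‖) ≤ ‖z‖ * (K * (‖R‖ * (1 + K) ^ n)) := by gcongr
    nlinarith
  · refine hn1.trans ?_
    have h1 := hcoef R G z e he hz hRG iG hG hP
    have h0 : 0 ≤ ‖z‖ * ((‖z‖ / e) ^ n * ‖R‖) := by positivity
    have : ‖z‖ * (K * ‖R * P ^ n‖) ≤ K * c * (1 + ‖z‖ * ((‖z‖ / e) ^ n * ‖R‖)) := by
      calc ‖z‖ * (K * ‖R * P ^ n‖) ≤ ‖z‖ * (K * (c * (1 / e + (‖z‖ / e) ^ n * ‖R‖))) := by gcongr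
        _ = K * c * (‖z‖ / e + ‖z‖ * ((‖z‖ / e) ^ n * ‖R‖)) := by ring
        _ ≤ _ := by
          gcongr
          exact (div_le_one he).2 hz
    nlinarith

/-- The low frequency part. -/
theorem aux_low (K : ℝ) (hK : 0 ≤ K) (n : ℕ) : ∃ c : ℝ, 0 ≤ c ∧
    ∀ (G J : X →L[ℂ] X) (e : ℝ), 0 < e → Commute G J →
      G - J = (1 - (e : ℂ)) • (G * J) → ‖G‖ ≤ K / e → ‖J‖ ≤ K →
      ‖(1 - J) - (1 - J) * (1 - (e : ℂ) • G) ^ n‖ ≤ c * e := by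
  refine ⟨(1 + K) * K * ∑ i ∈ Finset.range n, (1 + K) ^ i, by positivity,
    fun G J e he hGJ iJ hG hJ => ?_⟩
  have heG : ‖(e : ℂ) • G‖ ≤ K := by
    rw [norm_smul, Complex.norm_real, Real.norm_of_nonneg he.le]
    calc e * ‖G‖ ≤ e * (K / e) := by gcongr
      _ = K := by field_simp
  have hP := aux_one_sub_norm K _ heG
  set P := (1 - (e : ℂ) • G) with hPdef
  have h1 : (1 - P) = (e : ℂ) • G := by rw [hPdef]; abel
  have hgeom : 1 - P ^ n = (e : ℂ) • G * ∑ i ∈ Finset.range n, P ^ i := by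
    rw [← h1, mul_neg_geom_sum]
  have hJG : (1 - J) * G = P * J := by
    rw [sub_mul, one_mul, hPdef, sub_mul, one_mul, smul_mul_assoc]
    rw [sub_smul, one_smul] at iJ
    have : (e : ℂ) • (G * J) = G * J - (G - J) := by rw [iJ]; abel
    rw [this, hGJ.eq]; abel
  have e1 : (1 - J) - (1 - J) * P ^ n = (e : ℂ) • (P * J * ∑ i ∈ Finset.range n, P ^ i) := by
    calc (1 - J) - (1 - J) * P ^ n = (1 - J) * (1 - P ^ n) := by rw [mul_sub, mul_one]
      _ = _ := by rw [hgeom, smul_mul_assoc, mul_smul_comm, ← mul_assoc, hJG]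
  rw [e1, norm_smul, Complex.norm_real, Real.norm_of_nonneg he.le, mul_comm e]
  gcongr
  refine (norm_mul_le _ _).trans ?_
  gcongr
  · exact (norm_mul_le _ _).trans (by gcongr)
  · exact norm_sum_le_of_le _ fun i _ => aux_pow_norm K hK P hP i

end ResolventAlgebra
section Decay
open FourierTransform Topology

variable {X : Type*} [NormedAddCommGroup X]

theorem aux_integral_sq_eq {Y : Type*} [NormedAddCommGroup Y] {f : ℝ → X} {g : ℝ → Y}
    (hf : MemLp f 2) (hg : MemLp g 2)
    (h : eLpNorm f 2 volume = eLpNorm g 2 volume) : ∫ t, ‖f t‖ ^ 2 = ∫ t, ‖g t‖ ^ 2 := by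
  rw [hf.eLpNorm_eq_integral_rpow_norm (by norm_num) (by norm_num),
    hg.eLpNorm_eq_integral_rpow_norm (by norm_num) (by norm_num)] at h
  have h1 : (0 : ℝ) ≤ ∫ t, ‖f t‖ ^ (2 : ENNReal).toReal := integral_nonneg fun t => by positivity
  have h2 : (0 : ℝ) ≤ ∫ t, ‖g t‖ ^ (2 : ENNReal).toReal := integral_nonneg fun t => by positivity
  rw [ENNReal.ofReal_eq_ofReal_iff (by positivity) (by positivity)] at h
  have := (Real.rpow_left_inj h1 h2 (by norm_num)).1 h
  simpa using this

theorem aux_dom (g : ℝ → X) (C b : ℝ) (hb : 0 < b)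
    (hg : AEStronglyMeasurable g (volume.restrict (Ioi 0)))
    (hC : ∀ t : ℝ, 0 < t → ‖g t‖ ≤ C * Real.exp (-b * t)) :
    Integrable ((Ioi (0 : ℝ)).indicator g) ∧ MemLp ((Ioi (0 : ℝ)).indicator g) 2 ∧
      ∫ t, ‖(Ioi (0 : ℝ)).indicator g t‖ ^ 2 ≤ C ^ 2 / (2 * b) := by
  have hm : AEStronglyMeasurable ((Ioi (0 : ℝ)).indicator g) volume :=
    (aestronglyMeasurable_indicator_iff measurableSet_Ioi).2 hg
  have hi : IntegrableOn (fun t => C ^ 2 * Real.exp (-(2 * b) * t)) (Ioi 0) :=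
    (integrableOn_exp_mul_Ioi (by linarith) 0).const_mul _
  have hi2 := (integrable_indicator_iff measurableSet_Ioi).2 hi
  have hle : ∀ t, ‖(Ioi (0 : ℝ)).indicator g t‖ ^ 2 ≤
      (Ioi (0 : ℝ)).indicator (fun t => C ^ 2 * Real.exp (-(2 * b) * t)) t := by
    intro t
    by_cases ht : t ∈ Ioi (0 : ℝ)
    · rw [indicator_of_mem ht, indicator_of_mem ht]
      calc ‖g t‖ ^ 2 ≤ (C * Real.exp (-b * t)) ^ 2 := by
            gcongr
            exact hC t ht
        _ = _ := by rw [mul_pow, ← Real.exp_nat_mul]; congr 2; push_cast; ring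
    · rw [indicator_of_notMem ht, indicator_of_notMem ht]; simp
  have hsq : Integrable (fun t => ‖(Ioi (0 : ℝ)).indicator g t‖ ^ 2) := by
    refine Integrable.mono' hi2 (hm.norm.pow 2) (Eventually.of_forall fun t => ?_)
    rw [Real.norm_of_nonneg (by positivity)]
    exact hle t
  refine ⟨?_, ?_, ?_⟩
  · rw [integrable_indicator_iff measurableSet_Ioi]
    refine Integrable.mono' ((integrableOn_exp_mul_Ioi (a := -b) (by linarith) 0).const_mul C) hg ?_
    exact (ae_restrict_iff' measurableSet_Ioi).2 (Eventually.of_forall fun t ht => hC t ht)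
  · exact (memLp_two_iff_integrable_sq_norm hm).2 hsq
  · refine (integral_mono hsq hi2 hle).trans ?_
    rw [integral_indicator measurableSet_Ioi, integral_const_mul,
      integral_exp_mul_Ioi (by linarith)]
    simp
    apply le_of_eq; field_simp

theorem aux_plancherel_sq {X : Type*} [NormedAddCommGroup X] [InnerProductSpace ℂ X]
    [CompleteSpace X] (f : ℝ → X) (hf : Integrable f) (hf2 : MemLp f 2) :
    Integrable (fun w => ‖𝓕 f w‖ ^ 2) ∧ ∫ w, ‖𝓕 f w‖ ^ 2 = ∫ t, ‖f t‖ ^ 2 := by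
  have hcont : Continuous (𝓕 f) :=
    VectorFourier.fourierIntegral_continuous Real.continuous_fourierChar
      (L := innerₗ ℝ) continuous_inner hf
  have h := aux_plancherel f hf hf2
  have hm : MemLp (𝓕 f) 2 := ⟨hcont.aestronglyMeasurable, by rw [h]; exact hf2.2⟩
  exact ⟨(memLp_two_iff_integrable_sq_norm hm.1).1 hm, aux_integral_sq_eq hm hf2 h⟩

theorem aux_fourier_lap {X : Type*} [NormedAddCommGroup X] [NormedSpace ℂ X]
    (Tsg : C0Semigroup X) (a : ℝ) (x : X) (w : ℝ) :
    𝓕 ((Ioi (0 : ℝ)).indicator (fun t : ℝ => cexp (-(a : ℂ) * t) • Tsg.T t x)) w =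
      ∫ t in Ioi (0 : ℝ), cexp (-((a : ℂ) + Complex.I * ((2 * Real.pi * w : ℝ) : ℂ)) * t) •
        Tsg.T t x := by
  rw [Real.fourier_real_eq_integral_exp_smul, ← integral_indicator measurableSet_Ioi]
  congr 1
  ext t
  by_cases ht : t ∈ Ioi (0 : ℝ)
  · rw [indicator_of_mem ht, indicator_of_mem ht, smul_smul, ← Complex.exp_add]
    congr 2
    push_cast; ring
  · rw [indicator_of_notMem ht, indicator_of_notMem ht, smul_zero]

theorem aux_decay {X : Type*} [NormedAddCommGroup X] [InnerProductSpace ℂ X] [CompleteSpace X]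
    (Tsg : C0Semigroup X) (K : ℝ) (hK1 : 1 ≤ K)
    (hK : ∀ t : ℝ, 0 ≤ t → ‖Tsg.T t‖ ≤ K) (A : X →ₗ.[ℂ] X) (hgen : IsGenerator Tsg A)
    (Q : X →L[ℂ] X) (hQ : ∀ t : ℝ, 0 ≤ t → Q ∘L Tsg.T t = Tsg.T t ∘L Q)
    (N τ : ℝ) (hN0 : 0 ≤ N) (hτ : 0 < τ)
    (hN : ∀ s : ℝ, s ≠ 0 → ∀ G : X →L[ℂ] X, IsResolvent A ((τ⁻¹ : ℝ) + Complex.I * (s : ℂ)) G →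
      ‖G * Q‖ ≤ N) :
    ‖Tsg.T τ ∘L Q‖ ≤ 2 * Real.exp 1 * K ^ 2 * N / τ := by
  refine ContinuousLinearMap.opNorm_le_bound _ (by positivity) fun x => ?_
  set a : ℝ := τ⁻¹ with ha
  have ha0 : 0 < a := by positivity
  have hre : ∀ w : ℝ, 0 < ((a : ℂ) + Complex.I * ((2 * Real.pi * w : ℝ) : ℂ)).re := by
    intro w; simpa using ha0
  choose G hGres hGnorm hGint hGT using
    fun w : ℝ => aux_lap_resolvent Tsg K hK A hgen _ (hre w)
  have hmeas : ∀ y : X, AEStronglyMeasurable (fun t : ℝ => cexp (-(a : ℂ) * t) • Tsg.T t y)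
      (volume.restrict (Ioi 0)) := fun y =>
    ((aux_contOn Tsg a y).mono Ioi_subset_Ici_self).aestronglyMeasurable measurableSet_Ioi
  have hnorm : ∀ y : X, ∀ t : ℝ, 0 < t → ‖cexp (-(a : ℂ) * t) • Tsg.T t y‖ ≤
      K * ‖y‖ * Real.exp (-a * t) := fun y t ht => by
    simpa using aux_norm_le Tsg K hK a y t ht.le
  set f : X → ℝ → X := fun y =>
    (Ioi (0 : ℝ)).indicator (fun t : ℝ => cexp (-(a : ℂ) * t) • Tsg.T t y) with hf
  have hfd := fun y => aux_dom _ (K * ‖y‖) a ha0 (hmeas y) (hnorm y)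
  have hFf : ∀ y w, 𝓕 (f y) w = G w y := by
    intro y w
    rw [hGint w y]
    exact aux_fourier_lap Tsg a y w
  -- the function with factor t
  set f2 : ℝ → X := (Ioi (0 : ℝ)).indicator
    (fun t : ℝ => t • cexp (-(a : ℂ) * t) • Tsg.T t (Q x)) with hf2
  have hf2d := aux_dom (fun t : ℝ => t • cexp (-(a : ℂ) * t) • Tsg.T t (Q x))
    (2 / a * (K * ‖Q x‖)) (a / 2) (by positivity)
    (aestronglyMeasurable_id.smul (hmeas (Q x))) (by
      intro t ht
      rw [norm_smul, Real.norm_of_nonneg ht.le]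
      have h1 : t ≤ 2 / a * Real.exp (a / 2 * t) := by
        have := Real.add_one_le_exp (a / 2 * t)
        calc t = 2 / a * (a / 2 * t) := by field_simp
          _ ≤ _ := by gcongr; linarith
      calc t * ‖cexp (-(a : ℂ) * t) • Tsg.T t (Q x)‖
          ≤ 2 / a * Real.exp (a / 2 * t) * (K * ‖Q x‖ * Real.exp (-a * t)) := by
            gcongr
            exact hnorm _ t ht
        _ = 2 / a * (K * ‖Q x‖) * (Real.exp (a / 2 * t) * Real.exp (-a * t)) := by ring
        _ = _ := by rw [← Real.exp_add]; congr 2; ring)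
  have hf2f : ∀ t, f2 t = t • f (Q x) t := by
    intro t
    by_cases ht : t ∈ Ioi (0 : ℝ)
    · simp only [hf, hf2]; rw [indicator_of_mem ht, indicator_of_mem ht]
    · simp only [hf, hf2]; rw [indicator_of_notMem ht, indicator_of_notMem ht, smul_zero]
  have hF2 : ∀ w, 𝓕 f2 w = G w (G w (Q x)) := by
    intro w
    have hi2 : Integrable (fun t : ℝ => t • f (Q x) t) := by
      have := hf2d.1
      rwa [show (Ioi (0 : ℝ)).indicator
        (fun t : ℝ => t • cexp (-(a : ℂ) * t) • Tsg.T t (Q x)) = fun t : ℝ => t • f (Q x) t from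
          funext hf2f] at this
    have d1 := Real.hasDerivAt_fourier (hfd (Q x)).1 hi2 w
    have e1 : 𝓕 (fun t : ℝ => (-2 * Real.pi * Complex.I * t : ℂ) • f (Q x) t) w =
        (-2 * Real.pi * Complex.I : ℂ) • 𝓕 f2 w := by
      rw [Real.fourier_real_eq_integral_exp_smul, Real.fourier_real_eq_integral_exp_smul,
        ← integral_smul]
      congr 1
      ext t
      rw [hf2f t, ← Complex.coe_smul, smul_smul, smul_smul, smul_smul]
      congr 1
      ring
    have hcont : Continuous (𝓕 (f (G w (Q x)))) :=
      VectorFourier.fourierIntegral_continuous Real.continuous_fourierChar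
        (L := innerₗ ℝ) continuous_inner (hfd _).1
    have d2 : HasDerivAt (𝓕 (f (Q x))) ((-2 * Real.pi * Complex.I : ℂ) • G w (G w (Q x))) w := by
      rw [hasDerivAt_iff_tendsto_slope]
      have h1 : Tendsto (fun v => (-2 * Real.pi * Complex.I : ℂ) • 𝓕 (f (G w (Q x))) v) (𝓝[≠] w)
          (𝓝 ((-2 * Real.pi * Complex.I : ℂ) • G w (G w (Q x)))) := by
        rw [← hFf (G w (Q x)) w]
        exact ((hcont.tendsto w).mono_left nhdsWithin_le_nhds).const_smul
          (-2 * Real.pi * Complex.I : ℂ)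
      refine h1.congr' ?_
      filter_upwards [self_mem_nhdsWithin] with v hv
      have hvw : v - w ≠ 0 := sub_ne_zero.2 hv
      have hvw' : (v : ℂ) - w ≠ 0 := by exact_mod_cast hvw
      have hri := congrArg (fun F : X →L[ℂ] X => F (Q x)) (aux_res_ident (hGres v) (hGres w))
      rw [slope_def_module, hFf, hFf, hFf]
      have hri' : G v (Q x) - G w (Q x) =
        ((a : ℂ) + Complex.I * ((2 * Real.pi * w : ℝ) : ℂ) -
          ((a : ℂ) + Complex.I * ((2 * Real.pi * v : ℝ) : ℂ))) • G v (G w (Q x)) := hri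
      rw [hri', ← Complex.coe_smul, smul_smul]
      congr 1
      push_cast
      field_simp
      ring
    have h := d1.unique d2
    rw [e1] at h
    have hne : (-2 * Real.pi * Complex.I : ℂ) ≠ 0 := by
      simp [Real.pi_ne_zero]
    exact smul_right_injective X hne h
  have hGQ : ∀ w y, G w (Q y) = Q (G w y) := by
    intro w y
    rw [hGint w y, hGint w (Q y), ← ContinuousLinearMap.integral_comp_comm _
      (aux_integrable Tsg K hK _ (hre w) y)]
    refine setIntegral_congr_fun measurableSet_Ioi fun t ht => ?_
    have := congrArg (fun F : X →L[ℂ] X => F y) (hQ t (le_of_lt ht))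
    simp only [ContinuousLinearMap.comp_apply] at this
    simp only [map_smul, this]
  have hbound : ∀ w : ℝ, w ≠ 0 → ‖𝓕 f2 w‖ ^ 2 ≤ N ^ 2 * ‖𝓕 (f x) w‖ ^ 2 := by
    intro w hw
    rw [hF2, hFf, ← mul_pow, hGQ]
    gcongr
    have := hN (2 * Real.pi * w) (by simp [hw, Real.pi_ne_zero]) (G w) (hGres w)
    exact (G w * Q).le_of_opNorm_le this (G w x)
  obtain ⟨p1, p2⟩ := aux_plancherel_sq (f x) (hfd x).1 (hfd x).2.1
  obtain ⟨p3, p4⟩ := aux_plancherel_sq f2 hf2d.1 hf2d.2.1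
  have main : ∫ t, ‖f2 t‖ ^ 2 ≤ N ^ 2 * ((K * ‖x‖) ^ 2 / (2 * a)) := by
    calc ∫ t, ‖f2 t‖ ^ 2 = ∫ w, ‖𝓕 f2 w‖ ^ 2 := p4.symm
      _ ≤ ∫ w, N ^ 2 * ‖𝓕 (f x) w‖ ^ 2 := by
        refine integral_mono_ae p3 (p1.const_mul _) ?_
        have : ∀ᵐ w : ℝ, w ≠ 0 := by simp [ae_iff]
        filter_upwards [this] with w hw using hbound w hw
      _ = N ^ 2 * ∫ t, ‖f x t‖ ^ 2 := by rw [integral_const_mul, p2]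
      _ ≤ _ := by
        gcongr
        exact (hfd x).2.2
  have lower : (τ / 2) * ((τ / 2) * Real.exp (-1) * (‖Tsg.T τ (Q x)‖ / K)) ^ 2
      ≤ ∫ t, ‖f2 t‖ ^ 2 := by
    have hI : Integrable (fun t => ‖f2 t‖ ^ 2) :=
      (memLp_two_iff_integrable_sq_norm hf2d.2.1.1).1 hf2d.2.1
    calc (τ / 2) * ((τ / 2) * Real.exp (-1) * (‖Tsg.T τ (Q x)‖ / K)) ^ 2
        = ∫ t in Ioc (τ / 2) τ, ((τ / 2) * Real.exp (-1) * (‖Tsg.T τ (Q x)‖ / K)) ^ 2 := by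
          rw [setIntegral_const, measureReal_def, Real.volume_Ioc,
            ENNReal.toReal_ofReal (by linarith), smul_eq_mul]
          ring
      _ ≤ ∫ t in Ioc (τ / 2) τ, ‖f2 t‖ ^ 2 := by
          refine setIntegral_mono_on continuous_const.integrableOn_Ioc hI.integrableOn measurableSet_Ioc fun t ht => ?_
          have ht0 : 0 < t := by linarith [ht.1]
          simp only [hf2]
          rw [indicator_of_mem (show t ∈ Ioi (0 : ℝ) from ht0), norm_smul, norm_smul,
            Real.norm_of_nonneg ht0.le, aux_norm_exp, ← mul_assoc]
          gcongr
          · exact ht.1.le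
          · have : a * t ≤ 1 := by
              rw [ha, inv_mul_le_iff₀ hτ, mul_one]; exact ht.2
            simpa using this
          · rw [div_le_iff₀ (by linarith), mul_comm]
            have : Tsg.T τ (Q x) = Tsg.T (τ - t) (Tsg.T t (Q x)) := by
              rw [aux_T_comm Tsg (by linarith [ht.2]) ht0.le]; congr 2; ring
            rw [this]
            exact (Tsg.T (τ - t)).le_of_opNorm_le (hK _ (by linarith [ht.2])) _
      _ ≤ ∫ t, ‖f2 t‖ ^ 2 :=
          setIntegral_le_integral hI (Eventually.of_forall fun t => by positivity)
  have hfin := lower.trans main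
  have hK0 : 0 < K := by linarith
  have h3 : ((τ / 2) * Real.exp (-1) * (‖Tsg.T τ (Q x)‖ / K)) ^ 2 ≤ (N * (K * ‖x‖)) ^ 2 := by
    have e : N ^ 2 * ((K * ‖x‖) ^ 2 / (2 * a)) = (τ / 2) * (N * (K * ‖x‖)) ^ 2 := by
      rw [ha]; field_simp
    rw [e] at hfin
    exact le_of_mul_le_mul_left hfin (by positivity)
  have h4 := (pow_le_pow_iff_left₀ (by positivity) (by positivity) two_ne_zero).1 h3
  rw [Real.exp_neg] at h4
  change ‖Tsg.T τ (Q x)‖ ≤ _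
  have hE := Real.exp_pos 1
  calc ‖Tsg.T τ (Q x)‖ = (2 * Real.exp 1 * K / τ) *
        ((τ / 2) * (Real.exp 1)⁻¹ * (‖Tsg.T τ (Q x)‖ / K)) := by field_simp
    _ ≤ (2 * Real.exp 1 * K / τ) * (N * (K * ‖x‖)) := by gcongr
    _ = _ := by ring

end Decay
section Final
open Topology

theorem aux_res_bdd {X : Type*} [NormedAddCommGroup X] [NormedSpace ℂ X]
    (A : X →ₗ.[ℂ] X) (Res : ℝ → X →L[ℂ] X)
    (hRes : ∀ s : ℝ, s ≠ 0 → IsResolvent A (Complex.I * (s : ℂ)) (Res s))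
    (hbinf : ∃ C S : ℝ, ∀ s : ℝ, S ≤ |s| → ‖Res s‖ ≤ C) (d : ℝ) (hd : 0 < d) :
    ∃ C : ℝ, 0 ≤ C ∧ ∀ s : ℝ, d ≤ |s| → ‖Res s‖ ≤ C := by
  obtain ⟨C1, S, hS⟩ := hbinf
  have hcpt : IsCompact ({s : ℝ | d ≤ |s|} ∩ Icc (-S) S) :=
    isCompact_Icc.inter_left (isClosed_le continuous_const continuous_abs)
  have hC2 : ∃ C : ℝ, ∀ s ∈ ({s : ℝ | d ≤ |s|} ∩ Icc (-S) S), ‖Res s‖ ≤ C := by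
    refine hcpt.induction_on (p := fun t => ∃ C : ℝ, ∀ s ∈ t, ‖Res s‖ ≤ C) ?_ ?_ ?_ ?_
    · exact ⟨0, by simp⟩
    · rintro s t hst ⟨C, hC⟩
      exact ⟨C, fun x hx => hC x (hst hx)⟩
    · rintro s t ⟨C, hC⟩ ⟨D, hD⟩
      refine ⟨max C D, fun x hx => ?_⟩
      rcases hx with hx | hx
      · exact (hC x hx).trans (le_max_left _ _)
      · exact (hD x hx).trans (le_max_right _ _)
    · intro s0 hs0
      have hs00 : s0 ≠ 0 := by
        rintro rfl
        have : d ≤ |(0 : ℝ)| := hs0.1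
        simp at this; linarith
      have hev : ∀ᶠ s in 𝓝 s0, |s0 - s| * ‖Res s0‖ < 1 / 2 ∧ s ≠ 0 := by
        have h1 : Tendsto (fun s => |s0 - s| * ‖Res s0‖) (𝓝 s0) (𝓝 (|s0 - s0| * ‖Res s0‖)) :=
          Continuous.tendsto (by fun_prop) s0
        rw [sub_self, abs_zero, zero_mul] at h1
        exact (h1.eventually (gt_mem_nhds (by norm_num))).and (eventually_ne_nhds hs00)
      refine ⟨{s | |s0 - s| * ‖Res s0‖ < 1 / 2 ∧ s ≠ 0}, mem_nhdsWithin_of_mem_nhds hev,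
        2 * ‖Res s0‖, ?_⟩
      rintro s ⟨hs, hs1⟩
      have hri := aux_res_ident (hRes s hs1) (hRes s0 hs00)
      have h2 : ‖Res s - Res s0‖ ≤ |s0 - s| * (‖Res s‖ * ‖Res s0‖) := by
        rw [hri, norm_smul]
        gcongr
        · rw [← mul_sub, norm_mul, Complex.norm_I, one_mul, ← Complex.ofReal_sub,
            Complex.norm_real, Real.norm_eq_abs]
        · exact norm_mul_le _ _
      have h3 : ‖Res s‖ ≤ ‖Res s - Res s0‖ + ‖Res s0‖ := by
        simpa using norm_add_le (Res s - Res s0) (Res s0)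
      nlinarith [norm_nonneg (Res s)]
  obtain ⟨C2, hC2⟩ := hC2
  refine ⟨max 0 (max C1 C2), le_max_left _ _, fun s hs => ?_⟩
  by_cases h : S ≤ |s|
  · exact (hS s h).trans ((le_max_left _ _).trans (le_max_right _ _))
  · have : |s| ≤ S := (not_le.1 h).le
    exact (hC2 s ⟨hs, abs_le.1 this⟩).trans ((le_max_right _ _).trans (le_max_right _ _))

theorem aux_potter (l : ℝ → ℝ) (hsv : SlowlyVarying l) (hmono : Monotone l) (b : ℝ) (hb : 0 < b) :
    ∃ x0 : ℝ, 0 < x0 ∧ 0 < l x0 ∧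
      ∀ x y : ℝ, x0 ≤ x → x ≤ y → l y ≤ 2 ^ b * (y / x) ^ b * l x := by
  obtain ⟨-, hpos, hlim⟩ := hsv
  have h2b : (1 : ℝ) < 2 ^ b := Real.one_lt_rpow (by norm_num) hb
  have hev := (hlim 2 (by norm_num)).eventually (gt_mem_nhds h2b)
  obtain ⟨x1, hx1⟩ := eventually_atTop.1 (hev.and hpos)
  refine ⟨max x1 1, by positivity, (hx1 _ (le_max_left _ _)).2, fun x y hx hxy => ?_⟩
  have hx0 : 0 < x := lt_of_lt_of_le one_pos ((le_max_right _ _).trans hx)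
  have hstep : ∀ z, x ≤ z → l (2 * z) ≤ 2 ^ b * l z := by
    intro z hz
    have := hx1 z ((le_max_left _ _).trans (hx.trans hz))
    exact ((div_lt_iff₀ this.2).1 this.1).le
  have hiter : ∀ k : ℕ, l (2 ^ k * x) ≤ (2 ^ b) ^ k * l x := by
    intro k
    induction k with
    | zero => simp
    | succ k ih =>
      have h1 : x ≤ 2 ^ k * x := le_mul_of_one_le_left hx0.le (one_le_pow₀ (by norm_num))
      calc l (2 ^ (k + 1) * x) = l (2 * (2 ^ k * x)) := by congr 1; ring
        _ ≤ 2 ^ b * l (2 ^ k * x) := hstep _ h1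
        _ ≤ 2 ^ b * ((2 ^ b) ^ k * l x) := by gcongr
        _ = _ := by ring
  have hlx : 0 < l x := (hx1 x ((le_max_left _ _).trans hx)).2
  obtain ⟨n, hn1, hn2⟩ := exists_nat_pow_near ((one_le_div hx0).2 hxy) (one_lt_two (α := ℝ))
  calc l y ≤ l (2 ^ (n + 1) * x) := hmono ((div_lt_iff₀ hx0).1 hn2).le
    _ ≤ (2 ^ b) ^ (n + 1) * l x := hiter _
    _ = 2 ^ b * (2 ^ n : ℝ) ^ b * l x := by
      rw [pow_succ, ← Real.rpow_natCast, ← Real.rpow_mul (by norm_num), mul_comm b,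
        Real.rpow_mul (by norm_num), Real.rpow_natCast]
      ring
    _ ≤ _ := by gcongr

/-- The uniform estimate of the weighted resolvent. -/
theorem aux_unif {X : Type*} [NormedAddCommGroup X] [NormedSpace ℂ X]
    (A : X →ₗ.[ℂ] X) (Res : ℝ → X →L[ℂ] X)
    (hRes : ∀ s : ℝ, s ≠ 0 → IsResolvent A (Complex.I * (s : ℂ)) (Res s))
    (J : X →L[ℂ] X) (hJ : IsResolvent A 1 J) (K : ℝ) (hK : 0 ≤ K) (hJK : ‖J‖ ≤ K)
    (α : ℝ) (hα : 1 < α) (l : ℝ → ℝ) (hmono : Monotone l) (n : ℕ) (hn : α - 1 ≤ n)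
    (x0 : ℝ) (hx0 : 0 < x0) (hlx0 : 0 < l x0)
    (hpot : ∀ x y : ℝ, x0 ≤ x → x ≤ y → l y ≤ 2 ^ (α - 1) * (y / x) ^ (α - 1) * l x)
    (hb0 : ∃ C > (0 : ℝ), ∃ δ > (0 : ℝ), ∀ s : ℝ, 0 < |s| → |s| ≤ δ →
      ‖Res s‖ ≤ C * (|s| ^ α * l (|s|⁻¹))⁻¹)
    (hbinf : ∃ C S : ℝ, ∀ s : ℝ, S ≤ |s| → ‖Res s‖ ≤ C) :
    ∃ e0 : ℝ, 0 < e0 ∧ ∃ C : ℝ, 0 ≤ C ∧ ∀ e : ℝ, 0 < e → e ≤ e0 → ∀ G : X →L[ℂ] X,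
      IsResolvent A (e : ℂ) G → ‖G‖ ≤ K / e → ∀ s : ℝ, s ≠ 0 →
      ‖Res s * ((1 - J) * (1 - (e : ℂ) • G) ^ n)‖ ≤ C * ((e ^ (α - 1))⁻¹ / l e⁻¹) := by
  obtain ⟨C, hC, δ, hδ, hRb⟩ := hb0
  set e0 : ℝ := min δ x0⁻¹ with he0
  have he0pos : 0 < e0 := by positivity
  obtain ⟨D, hD, hRD⟩ := aux_res_bdd A Res hRes hbinf e0 he0pos
  obtain ⟨c, hc, hcRQ⟩ := aux_RQ (X := X) K hK n
  set b := α - 1 with hb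
  have hb0 : 0 < b := by linarith
  set c1 : ℝ := 2 ^ b * (x0 ^ b)⁻¹ * l x0 with hc1
  have hc10 : 0 < c1 := by positivity
  refine ⟨e0, he0pos, c * D * c1 + c * (c1 + C * 2 ^ b) + c * (c1 + C), by positivity,
    fun e he hee G hG hGK s hs => ?_⟩
  have hxe : x0 ≤ e⁻¹ := by
    rw [le_inv_comm₀ hx0 he]; exact hee.trans (min_le_right _ _)
  have hle : 0 < l e⁻¹ := hlx0.trans_le (hmono hxe)
  have heb : 0 < e ^ b := by positivity
  set m : ℝ := (e ^ b)⁻¹ / l e⁻¹ with hm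
  have hm0 : 0 < m := by positivity
  have h1m : 1 ≤ c1 * m := by
    have h := hpot x0 e⁻¹ le_rfl hxe
    rw [Real.div_rpow (by positivity) hx0.le, Real.inv_rpow he.le] at h
    have e1 : c1 * m = (2 ^ b * ((e ^ b)⁻¹ / x0 ^ b) * l x0) / l e⁻¹ := by
      rw [hc1, hm]; field_simp
    rw [e1, le_div_iff₀ hle, one_mul]
    exact h
  have hs0 : 0 < |s| := abs_pos.2 hs
  have hz : ‖Complex.I * (s : ℂ)‖ = |s| := by simp
  obtain ⟨b1, b2, b3⟩ := hcRQ (Res s) G J (Complex.I * s) e he (aux_res_comm (hRes s hs) hG)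
    (aux_res_comm (hRes s hs) hJ) (aux_res_ident (hRes s hs) hG) (aux_res_ident (hRes s hs) hJ)
    hGK hJK
  rw [hz] at b2 b3
  have t1 : 0 ≤ c * D * c1 * m := by positivity
  have t2 : 0 ≤ c * (c1 + C * 2 ^ b) * m := by positivity
  have t3 : 0 ≤ c * (c1 + C) * m := by positivity
  have hsα : |s| ^ α = |s| * |s| ^ b := by
    rw [hb, Real.rpow_sub_one hs0.ne']; field_simp
  have hsb : 0 < |s| ^ b := by positivity
  rcases le_or_gt e0 |s| with h | h
  · calc _ ≤ c * ‖Res s‖ := b1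
      _ ≤ c * D := by gcongr; exact hRD s h
      _ ≤ c * D * (c1 * m) := le_mul_of_one_le_right (by positivity) h1m
      _ ≤ _ := by linarith
  · have hR := hRb s hs0 (h.le.trans (min_le_left _ _))
    have hxs : x0 ≤ |s|⁻¹ := by
      rw [le_inv_comm₀ hx0 hs0]; exact h.le.trans (min_le_right _ _)
    have hls : 0 < l |s|⁻¹ := hlx0.trans_le (hmono hxs)
    rw [hsα] at hR
    rcases le_total e |s| with h' | h'
    · have hp := hpot |s|⁻¹ e⁻¹ hxs ((inv_le_inv₀ hs0 he).2 h')
      have e2 : e⁻¹ / |s|⁻¹ = |s| / e := by field_simp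
      rw [e2, Real.div_rpow hs0.le he.le] at hp
      have hk : |s| * ‖Res s‖ ≤ C * 2 ^ b * m := by
        calc |s| * ‖Res s‖ ≤ |s| * (C * (|s| * |s| ^ b * l |s|⁻¹)⁻¹) := by gcongr
          _ = C * ((|s| ^ b)⁻¹ / l |s|⁻¹) := by field_simp
          _ ≤ C * (2 ^ b * m) := by
            gcongr
            rw [hm, div_le_iff₀ hls]
            calc (|s| ^ b)⁻¹ = (|s| ^ b)⁻¹ / l e⁻¹ * l e⁻¹ := (div_mul_cancel₀ _ hle.ne').symm
              _ ≤ (|s| ^ b)⁻¹ / l e⁻¹ * (2 ^ b * (|s| ^ b / e ^ b) * l |s|⁻¹) := by gcongr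
              _ = _ := by field_simp
          _ = _ := by ring
      calc _ ≤ c * (1 + |s| * ‖Res s‖) := b2
        _ ≤ c * (c1 * m + C * 2 ^ b * m) := by gcongr
        _ ≤ _ := by linarith
    · have hk : |s| * ((|s| / e) ^ n * ‖Res s‖) ≤ C * m := by
        have hq : (|s| / e) ^ n ≤ |s| ^ b / e ^ b := by
          rw [← Real.div_rpow hs0.le he.le, ← Real.rpow_natCast]
          exact Real.rpow_le_rpow_of_exponent_ge (by positivity) ((div_le_one he).2 h') hn
        calc |s| * ((|s| / e) ^ n * ‖Res s‖)
            ≤ |s| * (|s| ^ b / e ^ b * (C * (|s| * |s| ^ b * l |s|⁻¹)⁻¹)) := by gcongr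
          _ = C * ((e ^ b)⁻¹ / l |s|⁻¹) := by field_simp
          _ ≤ C * m := by
            rw [hm]
            gcongr
            exact hmono ((inv_le_inv₀ he hs0).2 h')
      calc _ ≤ c * (1 + |s| * ((|s| / e) ^ n * ‖Res s‖)) := b3 h'
        _ ≤ c * (c1 * m + C * m) := by gcongr
        _ ≤ _ := by linarith

/-- The choice of the cut-off. -/
theorem aux_choice (α : ℝ) (hα : 1 < α) (l : ℝ → ℝ) (hsv : SlowlyVarying l) (hmono : Monotone l)
    (x0 : ℝ) (hlx0 : 0 < l x0) (e0 : ℝ) (he0 : 0 < e0) :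
    ∀ᶠ t : ℝ in atTop, 0 < (t * l (t ^ (1 / α))) ^ (-(1 / α)) ∧
      (t * l (t ^ (1 / α))) ^ (-(1 / α)) ≤ e0 ∧
      ((((t * l (t ^ (1 / α))) ^ (-(1 / α))) ^ (α - 1))⁻¹ /
        l ((t * l (t ^ (1 / α))) ^ (-(1 / α)))⁻¹) / t ≤
        2 * (t * l (t ^ (1 / α))) ^ (-(1 / α)) := by
  have hα0 : 0 < α := by linarith
  have hu : Tendsto (fun t : ℝ => t ^ (1 / α)) atTop atTop := tendsto_rpow_atTop (by positivity)
  set mu : ℝ := (l x0) ^ (1 / α) with hmu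
  have hmu0 : 0 < mu := by positivity
  have hlim := hu.eventually ((hsv.2.2 mu hmu0).eventually (lt_mem_nhds (show (1 / 2 : ℝ) < 1 by norm_num)))
  have hbig := hu.eventually (eventually_ge_atTop (max x0 (max (x0 / mu) (e0⁻¹ / mu))))
  filter_upwards [hlim, hbig, eventually_gt_atTop 0] with t h1 h2 ht
  set u := t ^ (1 / α) with hu'
  have hux : x0 ≤ u := (le_max_left _ _).trans h2
  have hue : e0⁻¹ / mu ≤ u := ((le_max_right _ _).trans (le_max_right _ _)).trans h2
  have hlu : 0 < l u := hlx0.trans_le (hmono hux)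
  have hp : 0 < t * l u := by positivity
  set e := (t * l u) ^ (-(1 / α)) with he
  have hepos : 0 < e := by positivity
  have hinv : e⁻¹ = (t * l u) ^ (1 / α) := by
    rw [he, Real.rpow_neg hp.le, inv_inv]
  have hinv2 : mu * u ≤ e⁻¹ := by
    rw [hinv, Real.mul_rpow ht.le hlu.le, mul_comm]
    gcongr
    exact Real.rpow_le_rpow hlx0.le (hmono hux) (by positivity)
  have heα : e ^ α = (t * l u)⁻¹ := by
    rw [he, ← Real.rpow_mul hp.le, ← Real.rpow_neg_one]
    congr 1
    field_simp
  have hle : 0 < l e⁻¹ := by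
    refine hlx0.trans_le (hmono (le_trans ?_ hinv2))
    have : x0 / mu ≤ u := ((le_max_left _ _).trans (le_max_right _ _)).trans h2
    rw [div_le_iff₀ hmu0] at this
    linarith
  refine ⟨hepos, ?_, ?_⟩
  · rw [div_le_iff₀ hmu0] at hue
    exact (inv_le_inv₀ he0 hepos).1 (by linarith)
  · have h3 : l u ≤ 2 * l e⁻¹ := by
      have := (lt_div_iff₀ hlu).1 h1
      have := hmono hinv2
      linarith
    have e1 : (e ^ (α - 1))⁻¹ = e * (t * l u) := by
      rw [Real.rpow_sub_one hepos.ne', heα]; field_simp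
    rw [e1, div_div, div_le_iff₀ (by positivity)]
    calc e * (t * l u) ≤ e * (t * (2 * l e⁻¹)) := by gcongr
      _ = _ := by ring

end Final
/-- Let `(T(t))_{t≥0}` be a bounded `C₀`-semigroup on a complex Hilbert
space `X` with generator `−A`.  Assume `σ(A) ∩ iℝ = {0}` (the resolvent `(is+A)⁻¹` exists
for `s ≠ 0` but `A` is not invertible), that
`‖(is+A)⁻¹‖ = O(1/(|s|^α ℓ(1/|s|)))` as `s → 0` and `‖(is+A)⁻¹‖ = O(1)` as `|s| → ∞`,
where `α > 1` and `ℓ` is an increasing slowly varying function.  Then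
`‖T(t)A(I+A)⁻¹‖ = O((t·ℓ(t^{1/α}))^{-1/α})` as `t → ∞`.
(Here `A(I+A)⁻¹ = 1 - (1+A)⁻¹ = 1 - J`.) -/
theorem decay_rate_singularity_at_zero_ell_increasing
    {X : Type*} [NormedAddCommGroup X] [InnerProductSpace ℂ X] [CompleteSpace X]
    (Tsg : C0Semigroup X) (hbdd : Tsg.Bounded)
    (A : X →ₗ.[ℂ] X) (hgen : IsGenerator Tsg A)
    (h0 : ¬ ∃ R : X →L[ℂ] X, IsResolvent A 0 R)
    (Res : ℝ → X →L[ℂ] X)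
    (hRes : ∀ s : ℝ, s ≠ 0 → IsResolvent A (Complex.I * (s : ℂ)) (Res s))
    (J : X →L[ℂ] X) (hJ : IsResolvent A 1 J)
    (α : ℝ) (hα : 1 < α)
    (l : ℝ → ℝ) (hsv : SlowlyVarying l) (hmono : Monotone l)
    (hb0 : ∃ C > (0 : ℝ), ∃ δ > (0 : ℝ), ∀ s : ℝ, 0 < |s| → |s| ≤ δ →
      ‖Res s‖ ≤ C * (|s| ^ α * l (|s|⁻¹))⁻¹)
    (hbinf : ∃ C S : ℝ, ∀ s : ℝ, S ≤ |s| → ‖Res s‖ ≤ C) :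
    (fun t : ℝ => ‖Tsg.T t ∘L ((1 : X →L[ℂ] X) - J)‖) =O[atTop]
      fun t : ℝ => (t * l (t ^ (1 / α))) ^ (-(1 / α)) := by
  obtain ⟨K0, hK0⟩ := hbdd
  set K : ℝ := max K0 1 with hKdef
  have hK1 : 1 ≤ K := le_max_right _ _
  have hKpos : 0 < K := by linarith
  have hK : ∀ t : ℝ, 0 ≤ t → ‖Tsg.T t‖ ≤ K := fun t ht => (hK0 t ht).trans (le_max_left _ _)
  have hJ' : ‖J‖ ≤ K ∧ ∀ t : ℝ, 0 ≤ t → J ∘L Tsg.T t = Tsg.T t ∘L J := by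
    obtain ⟨G, g1, g2, g3, g4⟩ := aux_lap_resolvent Tsg K hK A hgen 1 (by simp)
    rw [aux_res_unique hJ g1]
    exact ⟨by simpa using g2, g4⟩
  obtain ⟨hJK, hJT⟩ := hJ'
  obtain ⟨x0, hx0, hlx0, hpot⟩ := aux_potter l hsv hmono (α - 1) (by linarith)
  obtain ⟨n, hn⟩ := exists_nat_ge (α - 1)
  obtain ⟨e0, he0, C, hC, hunif⟩ := aux_unif A Res hRes J hJ K hKpos.le hJK α hα l hmono n hn
    x0 hx0 hlx0 hpot hb0 hbinf
  obtain ⟨c, hc, hlow⟩ := aux_low (X := X) K hKpos.le n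
  refine IsBigO.of_bound (K * c + 2 * Real.exp 1 * K ^ 2 * ((1 + K) * C) * 2) ?_
  filter_upwards [aux_choice α hα l hsv hmono x0 hlx0 e0 he0, eventually_gt_atTop 0] with t ht ht0
  set e : ℝ := (t * l (t ^ (1 / α))) ^ (-(1 / α)) with he
  obtain ⟨hepos, hee, hm⟩ := ht
  rw [norm_norm, Real.norm_of_nonneg hepos.le]
  obtain ⟨G, hG, hGn, -, hGT⟩ := aux_lap_resolvent Tsg K hK A hgen (e : ℂ) (by simpa using hepos)
  have hGK : ‖G‖ ≤ K / e := by simpa using hGn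
  set m : ℝ := ((e ^ (α - 1))⁻¹ / l e⁻¹) with hmdef
  set Q : X →L[ℂ] X := (1 - J) * (1 - (e : ℂ) • G) ^ n with hQdef
  have hQT : ∀ s : ℝ, 0 ≤ s → Q ∘L Tsg.T s = Tsg.T s ∘L Q := by
    intro s hs
    have c1 : Commute J (Tsg.T s) := hJT s hs
    have c2 : Commute G (Tsg.T s) := hGT s hs
    have c3 : Commute Q (Tsg.T s) :=
      ((Commute.one_left _).sub_left c1).mul_left
        ((((Commute.one_left _).sub_left (c2.smul_left _))).pow_left n)
    exact c3
  have hN0 : 0 ≤ (1 + K) * (C * m) := by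
    have := (norm_nonneg _).trans (hunif e hepos hee G hG hGK 1 one_ne_zero)
    positivity
  have hdec := aux_decay Tsg K hK1 hK A hgen Q hQT ((1 + K) * (C * m)) t hN0 ht0 (by
    intro s hs F hF
    have hare : 0 < (((t⁻¹ : ℝ) : ℂ) + Complex.I * (s : ℂ)).re := by simpa using ht0
    obtain ⟨F', f1, f2, -, -⟩ := aux_lap_resolvent Tsg K hK A hgen _ hare
    rw [← aux_res_unique hF f1] at f2
    have f3 : ‖((t⁻¹ : ℝ) : ℂ) • F‖ ≤ K := by
      rw [norm_smul, Complex.norm_real, Real.norm_of_nonneg (by positivity)]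
      have : ‖F‖ ≤ K / t⁻¹ := by simpa using f2
      rw [le_div_iff₀ (by positivity)] at this
      linarith
    have hri := aux_res_ident hF (hRes s hs)
    have hF2 : F = (1 - ((t⁻¹ : ℝ) : ℂ) • F) * Res s := by
      rw [sub_mul, one_mul, smul_mul_assoc]
      have : F = Res s + (F - Res s) := by abel
      nth_rewrite 1 [this]
      rw [hri, show (Complex.I * (s:ℂ) - (((t⁻¹ : ℝ) : ℂ) + Complex.I * (s:ℂ))) = -((t⁻¹ : ℝ) : ℂ) by ring, neg_smul, ← sub_eq_add_neg]
    rw [hF2, mul_assoc]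
    refine (norm_mul_le _ _).trans ?_
    gcongr
    · exact aux_one_sub_norm K _ f3
    · exact hunif e hepos hee G hG hGK s hs)
  have hl := hlow G J e hepos (aux_res_comm hG hJ) (aux_res_ident hG hJ) hGK hJK
  have hsplit : Tsg.T t ∘L ((1 : X →L[ℂ] X) - J) = Tsg.T t * ((1 - J) - Q) + Tsg.T t ∘L Q := by
    change Tsg.T t * (1 - J) = Tsg.T t * ((1 - J) - Q) + Tsg.T t * Q
    rw [← mul_add, sub_add_cancel]
  rw [hsplit]
  calc _ ≤ ‖Tsg.T t * ((1 - J) - Q)‖ + ‖Tsg.T t ∘L Q‖ := norm_add_le _ _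
    _ ≤ K * (c * e) + 2 * Real.exp 1 * K ^ 2 * ((1 + K) * (C * m)) / t := by
      gcongr
      refine (norm_mul_le _ _).trans ?_
      gcongr
      exact hK t ht0.le
    _ = K * (c * e) + 2 * Real.exp 1 * K ^ 2 * ((1 + K) * C) * (m / t) := by ring
    _ ≤ K * (c * e) + 2 * Real.exp 1 * K ^ 2 * ((1 + K) * C) * (2 * e) := by gcongr
    _ = _ := by ring
end

section
/- Let (T(t))_{t≥0} be a bounded C₀-semigroup on a complex Hilbert space X with generator −A. Assume σ(A) ∩ iℝ = {0}, let α ≥ 1, and write B(A) = A(I+A)^{-1}. Then the following are equivalent: (i) ‖(is+A)^{-1}‖ = O(|s|^{-α}) as s → 0 and ‖(is+A)^{-1}‖ = O(1) as |s| → ∞; (ii) ‖T(t)B(A)^α‖ = O(t^{-1}) as t → ∞; (iii) ‖T(t)B(A)‖ = O(t^{-1/α}) as t → ∞. -/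
open Filter MeasureTheory Set Complex Asymptotics

open Filter MeasureTheory Set Complex Asymptotics
/-! ### Plancherel for `L¹ ∩ L²` functions -/
section Planch
open FourierTransform SchwartzMap
open scoped ContDiff

theorem my_fourier_ae {X : Type*} [NormedAddCommGroup X] [InnerProductSpace ℂ X] [CompleteSpace X]
    (f : ℝ → X) (h1 : Integrable f) (h2 : MemLp f 2 volume) :
    (𝓕 (h2.toLp f) : Lp (α := ℝ) X 2 volume) =ᵐ[volume] (𝓕 f : ℝ → X) := by
  have hcont : Continuous (𝓕 f : ℝ → X) :=
    VectorFourier.fourierIntegral_continuous Real.continuous_fourierChar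
      (by exact continuous_inner) h1
  refine ae_eq_of_integral_contDiff_smul_eq ?_ hcont.locallyIntegrable ?_
  · exact (Lp.memLp (𝓕 (h2.toLp f) : Lp (α := ℝ) X 2 volume)).locallyIntegrable (by norm_num)
  intro g g_smooth g_cpt
  have hg₁ : HasCompactSupport (Complex.ofRealCLM ∘ g) := g_cpt.comp_left rfl
  have hg₂ : ContDiff ℝ ∞ (Complex.ofRealCLM ∘ g) := by fun_prop
  set G : 𝓢(ℝ, ℂ) := hg₁.toSchwartzMap hg₂ with hG
  have hGx : ∀ x, G x = (g x : ℂ) := fun x => by simp [hG]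
  have e1 := congrArg (fun D => D G) (Lp.fourier_toTemperedDistribution_eq (h2.toLp f))
  simp only [TemperedDistribution.fourier_apply, Lp.toTemperedDistribution_apply] at e1
  have e2 : ∫ x, (𝓕 G) x • (h2.toLp f) x = ∫ x, (𝓕 (G : ℝ → ℂ)) x • f x := by
    apply integral_congr_ae
    filter_upwards [h2.coeFn_toLp] with x hx
    rw [hx, SchwartzMap.fourier_coe]
  have e3 : ∫ x, (𝓕 (G : ℝ → ℂ)) x • f x = ∫ x, G x • (𝓕 f) x :=
    by simpa using! (VectorFourier.integral_fourierIntegral_smul_eq_flip (L := innerₗ ℝ)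
      Real.continuous_fourierChar continuous_inner G.integrable h1)
  calc _ = ∫ x, G x • (𝓕 (h2.toLp f) : Lp (α := ℝ) X 2 volume) x := by
        congr 1
    _ = ∫ x, G x • (𝓕 f) x := by rw [← e1, e2, e3]
    _ = _ := by congr 1

theorem my_plancherel {X : Type*} [NormedAddCommGroup X] [InnerProductSpace ℂ X] [CompleteSpace X]
    (f : ℝ → X) (h1 : Integrable f) (h2 : MemLp f 2 volume) :
    eLpNorm (𝓕 f : ℝ → X) 2 volume = eLpNorm f 2 volume := by
  rw [← eLpNorm_congr_ae (my_fourier_ae f h1 h2), ← eLpNorm_congr_ae h2.coeFn_toLp]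
  have := Lp.norm_fourier_eq (h2.toLp f)
  rw [Lp.norm_def, Lp.norm_def] at this
  exact (ENNReal.toReal_eq_toReal_iff' (Lp.eLpNorm_ne_top _) (Lp.eLpNorm_ne_top _)).1 this

/-- Fourier multipliers bounded by `M` do not increase `L²` norms by more than `M`. -/
theorem my_multiplier {X : Type*} [NormedAddCommGroup X] [InnerProductSpace ℂ X] [CompleteSpace X]
    (f u : ℝ → X) (hf1 : Integrable f) (hf2 : MemLp f 2 volume)
    (hu1 : Integrable u) (hu2 : MemLp u 2 volume) (M : ℝ) (hM : 0 ≤ M)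
    (h : ∀ ξ : ℝ, ξ ≠ 0 → ‖(𝓕 u : ℝ → X) ξ‖ ≤ M * ‖(𝓕 f : ℝ → X) ξ‖) :
    ∫ τ, ‖u τ‖ ^ 2 ≤ M ^ 2 * ∫ τ, ‖f τ‖ ^ 2 := by
  have hle : eLpNorm (𝓕 u : ℝ → X) 2 volume ≤ ENNReal.ofReal M * eLpNorm (𝓕 f : ℝ → X) 2 volume := by
    apply eLpNorm_le_mul_eLpNorm_of_ae_le_mul
    have : ∀ᵐ ξ : ℝ, ξ ≠ 0 := by simp [ae_iff]
    filter_upwards [this] with ξ hξ using h ξ hξ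
  rw [my_plancherel f hf1 hf2, my_plancherel u hu1 hu2] at hle
  have key : ∀ w : ℝ → X, MemLp w 2 volume → ∫ τ, ‖w τ‖ ^ 2 = (eLpNorm w 2 volume).toReal ^ 2 := by
    intro w hw
    have := hw.eLpNorm_eq_integral_rpow_norm (by norm_num) (by norm_num)
    rw [this]
    have hn : 0 ≤ ∫ τ, ‖w τ‖ ^ 2 := integral_nonneg (fun _ => by positivity)
    simp only [ENNReal.toReal_ofNat, Real.rpow_two]
    rw [ENNReal.toReal_ofReal (by positivity), ← Real.rpow_natCast, ← Real.rpow_mul hn]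
    norm_num
  rw [key f hf2, key u hu2, ← mul_pow]
  apply pow_le_pow_left₀ ENNReal.toReal_nonneg
  have := ENNReal.toReal_mono (ENNReal.mul_ne_top ENNReal.ofReal_ne_top hf2.eLpNorm_ne_top) hle
  rwa [ENNReal.toReal_mul, ENNReal.toReal_ofReal hM] at this
end Planch

open Filter MeasureTheory Set Complex Asymptotics

/-! ### Exponentially decaying functions on the half line -/
section ExpDecay
open scoped Topology

variable {X : Type*} [NormedAddCommGroup X]

theorem expDecay_integrableOn {F : ℝ → X} (hF : ContinuousOn F (Ici 0)) {C a : ℝ} (ha : 0 < a)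
    (hb : ∀ τ : ℝ, 0 < τ → ‖F τ‖ ≤ C * Real.exp (-a * τ)) :
    IntegrableOn F (Ioi 0) volume := by
  have h1 : IntegrableOn (fun τ : ℝ => C * Real.exp (-a * τ)) (Ioi 0) volume :=
    (exp_neg_integrableOn_Ioi 0 ha).const_mul C
  refine Integrable.mono' h1 ((hF.mono Ioi_subset_Ici_self).aestronglyMeasurable measurableSet_Ioi) ?_
  exact (ae_restrict_iff' measurableSet_Ioi).2 (Eventually.of_forall fun τ hτ => hb τ hτ)

theorem expDecay_sq {F : ℝ → X} (hF : ContinuousOn F (Ici 0)) {C a : ℝ} (ha : 0 < a)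
    (hb : ∀ τ : ℝ, 0 < τ → ‖F τ‖ ≤ C * Real.exp (-a * τ)) :
    IntegrableOn (fun τ => ‖F τ‖ ^ 2) (Ioi 0) volume ∧
      ∫ τ in Ioi 0, ‖F τ‖ ^ 2 ≤ C ^ 2 / (2 * a) := by
  have hb2 : ∀ τ : ℝ, 0 < τ → ‖F τ‖ ^ 2 ≤ C ^ 2 * Real.exp (-(2 * a) * τ) := by
    intro τ hτ
    have := pow_le_pow_left₀ (norm_nonneg _) (hb τ hτ) 2
    rw [mul_pow, ← Real.exp_nat_mul] at this
    rwa [show ((2 : ℕ) : ℝ) * (-a * τ) = -(2 * a) * τ by push_cast; ring] at this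
  have h1 : IntegrableOn (fun τ : ℝ => C ^ 2 * Real.exp (-(2 * a) * τ)) (Ioi 0) volume :=
    (exp_neg_integrableOn_Ioi 0 (by positivity)).const_mul _
  have h2 : IntegrableOn (fun τ => ‖F τ‖ ^ 2) (Ioi 0) volume := by
    refine Integrable.mono' h1 (((hF.mono Ioi_subset_Ici_self).norm.pow 2).aestronglyMeasurable
      measurableSet_Ioi) ?_
    refine (ae_restrict_iff' measurableSet_Ioi).2 (Eventually.of_forall fun τ hτ => ?_)
    simpa using hb2 τ hτ
  refine ⟨h2, (setIntegral_mono_on h2 h1 measurableSet_Ioi fun τ hτ => hb2 τ hτ).trans ?_⟩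
  rw [integral_const_mul, integral_exp_mul_Ioi (by linarith)]
  apply le_of_eq
  simp
  field_simp

theorem expDecay_indicator {F : ℝ → X} (hF : ContinuousOn F (Ici 0)) {C a : ℝ} (ha : 0 < a)
    (hb : ∀ τ : ℝ, 0 < τ → ‖F τ‖ ≤ C * Real.exp (-a * τ)) :
    Integrable ((Ioi 0).indicator F) volume ∧ MemLp ((Ioi 0).indicator F) 2 volume := by
  have h1 := (expDecay_integrableOn hF ha hb)
  have h1' : Integrable ((Ioi 0).indicator F) volume := h1.integrable_indicator measurableSet_Ioi
  refine ⟨h1', ?_⟩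
  rw [memLp_two_iff_integrable_sq_norm h1'.aestronglyMeasurable]
  have := (expDecay_sq hF ha hb).1.integrable_indicator measurableSet_Ioi
  refine this.congr (Eventually.of_forall fun τ => ?_)
  by_cases h : τ ∈ Ioi (0 : ℝ) <;> simp [h, indicator]

theorem mul_exp_le {a τ : ℝ} (ha : 0 < a) (_hτ : 0 ≤ τ) :
    τ * Real.exp (-a * τ) ≤ (2 / a) * Real.exp (-(a / 2) * τ) := by
  have h := Real.add_one_le_exp (a / 2 * τ)
  have h2 : Real.exp (-a * τ) = Real.exp (-(a / 2) * τ) * Real.exp (-(a / 2) * τ) := by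
    rw [← Real.exp_add]; ring_nf
  have h3 : Real.exp (a / 2 * τ) * Real.exp (-(a / 2) * τ) = 1 := by
    rw [← Real.exp_add]; simp
  have h4 : 0 < Real.exp (-(a / 2) * τ) := Real.exp_pos _
  rw [h2, ← mul_assoc]
  apply mul_le_mul_of_nonneg_right _ h4.le
  rw [le_div_iff₀ ha]
  nlinarith
end ExpDecay

/-! ### Basic semigroup facts -/
section SG
open scoped Topology

variable {X : Type*} [NormedAddCommGroup X] [NormedSpace ℂ X]
  {Tsg : C0Semigroup X} {A : X →ₗ.[ℂ] X}

theorem gen_tendsto (hgen : IsGenerator Tsg A) (z : A.domain) :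
    Tendsto (fun t : ℝ => (t : ℂ)⁻¹ • (Tsg.T t (z : X) - z)) (𝓝[>] 0) (𝓝 (-(A z))) :=
  (hgen z (A z)).1 ⟨z.2, rfl⟩

theorem gen_comm (hgen : IsGenerator Tsg A) {S : X →L[ℂ] X}
    (hS : ∀ t : ℝ, 0 ≤ t → ∀ x, S (Tsg.T t x) = Tsg.T t (S x)) (z : A.domain) :
    ∃ h : S z ∈ A.domain, A ⟨S z, h⟩ = S (A z) := by
  refine (hgen _ _).2 ?_
  have := (S.continuous.tendsto _).comp (gen_tendsto hgen z)
  rw [map_neg] at this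
  refine this.congr' ?_
  filter_upwards [self_mem_nhdsWithin] with t ht
  simp [hS t (le_of_lt ht)]

theorem T_comm (Tsg : C0Semigroup X) {s t : ℝ} (hs : 0 ≤ s) (ht : 0 ≤ t) (x : X) :
    Tsg.T s (Tsg.T t x) = Tsg.T t (Tsg.T s x) := by
  have h1 := Tsg.map_add s t hs ht
  have h2 := Tsg.map_add t s ht hs
  rw [add_comm, h2] at h1
  exact (congrArg (fun L => L x) h1).symm

theorem orbit_deriv (hgen : IsGenerator Tsg A) (z : A.domain) {t : ℝ} (ht : 0 ≤ t) :
    HasDerivWithinAt (fun τ => Tsg.T τ (z : X)) (-(Tsg.T t (A z))) (Ici t) t := by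
  rw [← hasDerivWithinAt_Ioi_iff_Ici, hasDerivWithinAt_iff_tendsto_slope' (by simp)]
  have h1 := ((Tsg.T t).continuous.tendsto _).comp (gen_tendsto hgen z)
  rw [map_neg] at h1
  have h2 : Tendsto (fun τ : ℝ => τ - t) (𝓝[>] t) (𝓝[>] 0) := by
    refine tendsto_nhdsWithin_iff.2 ⟨?_, ?_⟩
    · have : Tendsto (fun τ : ℝ => τ - t) (𝓝 t) (𝓝 (t - t)) := by
        exact (continuous_id.sub continuous_const).tendsto t
      rw [sub_self] at this
      exact this.mono_left nhdsWithin_le_nhds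
    · filter_upwards [self_mem_nhdsWithin] with τ hτ
      simpa using hτ
  refine (h1.comp h2).congr' ?_
  filter_upwards [self_mem_nhdsWithin] with τ hτ
  have hτ' : 0 ≤ τ - t := by have : t < τ := hτ; linarith
  have e : Tsg.T τ = Tsg.T t ∘L Tsg.T (τ - t) := by
    rw [← Tsg.map_add t (τ - t) ht hτ']; ring_nf
  simp only [Function.comp, slope_def_module, e, ContinuousLinearMap.comp_apply, map_smul, map_sub]
  rw [RCLike.real_smul_eq_coe_smul (K := ℂ)]
  simp

theorem exp_deriv (lam : ℂ) (t : ℝ) (s : Set ℝ) :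
    HasDerivWithinAt (fun τ : ℝ => Complex.exp (-(lam * τ))) (-(lam * Complex.exp (-(lam * t)))) s t := by
  have h1 : HasDerivAt (fun τ : ℝ => (τ : ℂ)) 1 t := Complex.ofRealCLM.hasDerivAt
  have := ((h1.const_mul lam).neg).cexp
  have e : Complex.exp (-(lam * t)) * -(lam * 1) = -(lam * Complex.exp (-(lam * t))) := by ring
  rw [← e]
  exact this.hasDerivWithinAt

theorem norm_cexp (lam : ℂ) (t : ℝ) : ‖Complex.exp (-(lam * t))‖ = Real.exp (-lam.re * t) := by
  simp [Complex.norm_exp]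

/-- derivative of the rescaled orbit -/
theorem eorbit_deriv (hgen : IsGenerator Tsg A) (lam : ℂ) (z : A.domain) {t : ℝ} (ht : 0 ≤ t) :
    HasDerivWithinAt (fun τ : ℝ => Complex.exp (-(lam * τ)) • Tsg.T τ (z : X))
      (-(Complex.exp (-(lam * t)) • Tsg.T t (lam • (z : X) + A z))) (Ici t) t := by
  have := (exp_deriv lam t (Ici t)).smul (orbit_deriv hgen z ht)
  have e : -(Complex.exp (-(lam * t)) • Tsg.T t (lam • (z : X) + A z)) =
      Complex.exp (-(lam * t)) • -(Tsg.T t (A z)) +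
        (-(lam * Complex.exp (-(lam * t)))) • Tsg.T t (z : X) := by
    simp only [map_add, map_smul, smul_add, smul_neg, neg_smul, smul_smul]
    rw [neg_add, add_comm, mul_comm (Complex.exp _) lam]
  rw [e]
  exact this

theorem eorbit_cont (Tsg : C0Semigroup X) (lam : ℂ) (x : X) :
    ContinuousOn (fun τ : ℝ => Complex.exp (-(lam * τ)) • Tsg.T τ x) (Ici 0) := by
  refine ContinuousOn.smul (Continuous.continuousOn (by fun_prop)) (Tsg.strong_continuity x)

theorem eorbit_bound {K : ℝ} (hK : ∀ t : ℝ, 0 ≤ t → ‖Tsg.T t‖ ≤ K) (lam : ℂ) (x : X) {τ : ℝ}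
    (hτ : 0 ≤ τ) :
    ‖Complex.exp (-(lam * τ)) • Tsg.T τ x‖ ≤ (K * ‖x‖) * Real.exp (-lam.re * τ) := by
  rw [norm_smul, norm_cexp, mul_comm]
  exact mul_le_mul_of_nonneg_right ((Tsg.T τ).le_of_opNorm_le (hK τ hτ) x) (Real.exp_pos _).le

theorem lower_bound (hgen : IsGenerator Tsg A) {K : ℝ} (hK : ∀ t : ℝ, 0 ≤ t → ‖Tsg.T t‖ ≤ K)
    (s : ℝ) (z : A.domain) {t : ℝ} (ht : 0 ≤ t) :
    ‖(z : X)‖ ≤ ‖Tsg.T t (z : X)‖ + K * t * ‖(Complex.I * s) • (z : X) + A z‖ := by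
  have h := norm_image_sub_le_of_norm_deriv_right_le_segment (a := 0) (b := t)
    (f := fun τ : ℝ => Complex.exp (-(Complex.I * s * τ)) • Tsg.T τ (z : X))
    (C := K * ‖(Complex.I * s) • (z : X) + A z‖)
    ((eorbit_cont Tsg _ _).mono Icc_subset_Ici_self)
    (fun x hx => eorbit_deriv hgen (Complex.I * s) z hx.1)
    (fun x hx => by
      rw [norm_neg]
      have := eorbit_bound hK (Complex.I * s) ((Complex.I * s) • (z : X) + A z) hx.1
      simpa using this) t ⟨ht, le_rfl⟩
  have e0 : Complex.exp (-(Complex.I * s * (0:ℝ))) • Tsg.T 0 (z : X) = z := by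
    simp [Tsg.map_zero]
  simp only [e0] at h
  have h2 := norm_sub_norm_le (z : X) (Complex.exp (-(Complex.I * s * t)) • Tsg.T t (z : X))
  rw [norm_sub_rev, norm_smul, norm_cexp] at h2
  simp at h2 h
  nlinarith
end SG

open Filter MeasureTheory Set Complex Asymptotics

/-! ### Laplace transform and resolvent -/
section Lap
open scoped Topology

variable {X : Type*} [NormedAddCommGroup X] [NormedSpace ℂ X]
  {Tsg : C0Semigroup X} {A : X →ₗ.[ℂ] X}

theorem resolvent_unique {lam : ℂ} {R R' : X →L[ℂ] X} (h : IsResolvent A lam R)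
    (h' : IsResolvent A lam R') : R = R' := by
  ext x
  have := h.left_inv ⟨R' x, h'.mem_domain x⟩
  rwa [h'.eq_apply x] at this

theorem resolvent_T_comm (hgen : IsGenerator Tsg A) {lam : ℂ} {R : X →L[ℂ] X}
    (h : IsResolvent A lam R) {t : ℝ} (ht : 0 ≤ t) (x : X) : R (Tsg.T t x) = Tsg.T t (R x) := by
  obtain ⟨h1, h2⟩ := gen_comm hgen (S := Tsg.T t) (fun s hs y => T_comm Tsg ht hs y)
    ⟨R x, h.mem_domain x⟩
  have h3 := h.left_inv ⟨_, h1⟩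
  rw [h2] at h3
  rw [← map_smul (Tsg.T t) lam, ← map_add (Tsg.T t), h.eq_apply x] at h3
  exact h3

theorem resolvent_identity {lam mu : ℂ} {R S : X →L[ℂ] X} (hR : IsResolvent A lam R)
    (hS : IsResolvent A mu S) (x : X) : S x = R x + (lam - mu) • R (S x) := by
  have h1 := hR.left_inv ⟨S x, hS.mem_domain x⟩
  have h2 := hS.eq_apply x
  have h3 : A ⟨S x, hS.mem_domain x⟩ = x - mu • S x := eq_sub_of_add_eq' h2
  rw [h3] at h1
  simp only at h1
  conv_lhs => rw [← h1]
  rw [map_add, map_sub, map_smul, map_smul]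
  module

theorem resolvent_comm {lam mu : ℂ} {R S : X →L[ℂ] X} (hR : IsResolvent A lam R)
    (hS : IsResolvent A mu S) (x : X) : R (S x) = S (R x) := by
  by_cases h : lam = mu
  · subst h; rw [resolvent_unique hR hS]
  have h1 := resolvent_identity hR hS x
  have h2 := resolvent_identity hS hR x
  have h3 : (lam - mu) • (R (S x) - S (R x)) = 0 := by
    rw [h2] at h1
    have : (lam - mu) • R (S x) = (S x) - (S x + (mu - lam) • S (R x)) := by
      nth_rewrite 2 [h1]; abel
    rw [smul_sub, this]; module
  rw [smul_eq_zero, sub_eq_zero, sub_eq_zero] at h3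
  exact h3.resolve_left h

variable [CompleteSpace X]

theorem exists_laplace (hgen : IsGenerator Tsg A) {K : ℝ} (hK : ∀ t : ℝ, 0 ≤ t → ‖Tsg.T t‖ ≤ K)
    (lam : ℂ) (hlam : 0 < lam.re) :
    ∃ R : X →L[ℂ] X, IsResolvent A lam R ∧
      (∀ x, R x = ∫ τ in Ioi (0 : ℝ), Complex.exp (-(lam * τ)) • Tsg.T τ x) ∧
      ‖R‖ ≤ K / lam.re := by
  have hK0 : 0 ≤ K := (norm_nonneg _).trans (hK 0 le_rfl)
  have hint : ∀ x, IntegrableOn (fun τ : ℝ => Complex.exp (-(lam * τ)) • Tsg.T τ x) (Ioi 0) :=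
    fun x => expDecay_integrableOn (eorbit_cont Tsg lam x) hlam
      (fun τ hτ => eorbit_bound hK lam x (le_of_lt hτ))
  let L : X →ₗ[ℂ] X :=
    { toFun := fun x => ∫ τ in Ioi (0 : ℝ), Complex.exp (-(lam * τ)) • Tsg.T τ x
      map_add' := fun x y => by
        rw [← integral_add (hint x) (hint y)]
        simp [smul_add]
      map_smul' := fun c x => by
        rw [RingHom.id_apply, ← integral_smul]
        simp only [map_smul, smul_comm c] }
  have hLb : ∀ x, ‖L x‖ ≤ K / lam.re * ‖x‖ := by
    intro x
    have h1 : IntegrableOn (fun τ : ℝ => (K * ‖x‖) * Real.exp (-lam.re * τ)) (Ioi 0) volume :=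
      (exp_neg_integrableOn_Ioi 0 hlam).const_mul _
    have h2 := norm_integral_le_of_norm_le h1
      ((ae_restrict_iff' measurableSet_Ioi).2 (Eventually.of_forall fun τ hτ =>
        eorbit_bound hK lam x (le_of_lt (show (0:ℝ) < τ from hτ))))
    refine h2.trans (le_of_eq ?_)
    rw [integral_const_mul, integral_exp_mul_Ioi (by linarith)]
    simp
    field_simp
  let R : X →L[ℂ] X := L.mkContinuous _ hLb
  have hR : ∀ x, R x = ∫ τ in Ioi (0 : ℝ), Complex.exp (-(lam * τ)) • Tsg.T τ x := fun x => rfl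
  have hRn : ‖R‖ ≤ K / lam.re := L.mkContinuous_norm_le (by positivity) hLb
  -- translation
  have hTR : ∀ (h : ℝ), 0 ≤ h → ∀ x, Tsg.T h (R x) =
      Complex.exp (lam * h) • (R x - ∫ τ in (0 : ℝ)..h, Complex.exp (-(lam * τ)) • Tsg.T τ x) := by
    intro h hh x
    have e1 : R x - ∫ τ in (0 : ℝ)..h, Complex.exp (-(lam * τ)) • Tsg.T τ x =
        ∫ τ in Ioi h, Complex.exp (-(lam * τ)) • Tsg.T τ x := by
      rw [hR, sub_eq_iff_eq_add', intervalIntegral.integral_interval_add_Ioi (hint x)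
        ((hint x).mono_set (Ioi_subset_Ioi hh))]
    rw [e1, hR, ← ContinuousLinearMap.integral_comp_comm _ (hint x)]
    have e2 : ∫ τ in Ioi (0:ℝ), (fun τ : ℝ => Complex.exp (-(lam * τ)) • Tsg.T τ x) (τ + h) =
        ∫ τ in Ioi h, Complex.exp (-(lam * τ)) • Tsg.T τ x := by
      have := (measurePreserving_add_right volume h).setIntegral_preimage_emb
        (measurableEmbedding_addRight h)
        (fun τ : ℝ => Complex.exp (-(lam * τ)) • Tsg.T τ x) (Ioi h)
      rw [← this]
      congr 2
      simp
    rw [← e2, ← integral_smul]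
    refine setIntegral_congr_fun measurableSet_Ioi fun τ hτ => ?_
    have hτ' : (0:ℝ) ≤ τ := le_of_lt hτ
    simp only [map_smul, smul_smul]
    rw [add_comm τ h, Tsg.map_add h τ hh hτ', ← Complex.exp_add]
    simp only [ContinuousLinearMap.comp_apply]
    congr 2
    push_cast; ring
  have hcomm : ∀ t : ℝ, 0 ≤ t → ∀ x, R (Tsg.T t x) = Tsg.T t (R x) := by
    intro t ht x
    rw [hR, hR, ← ContinuousLinearMap.integral_comp_comm _ (hint x)]
    refine setIntegral_congr_fun measurableSet_Ioi fun τ hτ => ?_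
    simp only [map_smul]
    rw [T_comm Tsg ht (le_of_lt hτ)]
  have hgenR : ∀ x, ∃ h : R x ∈ A.domain, A ⟨R x, h⟩ = x - lam • R x := by
    intro x
    refine (hgen _ _).2 ?_
    have hc : ContinuousOn (fun τ : ℝ => Complex.exp (-(lam * τ)) • Tsg.T τ x) (Ici 0) :=
      eorbit_cont Tsg lam x
    have d1 : HasDerivWithinAt
        (fun h : ℝ => ∫ τ in (0 : ℝ)..h, Complex.exp (-(lam * τ)) • Tsg.T τ x)
        x (Ici 0) 0 := by
      have := intervalIntegral.integral_hasDerivWithinAt_right (a := 0) (b := 0)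
        (f := fun τ : ℝ => Complex.exp (-(lam * τ)) • Tsg.T τ x) (s := Ici 0) (t := Ioi 0)
        (by simp) ?_ ?_
      · simpa [Tsg.map_zero] using this
      · refine ⟨Ioi 0, self_mem_nhdsWithin, ?_⟩
        exact (hc.mono Ioi_subset_Ici_self).aestronglyMeasurable measurableSet_Ioi
      · exact (hc 0 self_mem_Ici).mono Ioi_subset_Ici_self
    have d2 : HasDerivWithinAt (fun h : ℝ => Complex.exp (lam * h)) lam (Ici 0) 0 := by
      have := exp_deriv (-lam) 0 (Ici 0)
      simpa using this
    have d3 := d2.smul (d1.const_sub (R x))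
    have d4 := (hasDerivWithinAt_Ioi_iff_Ici.2 d3)
    rw [hasDerivWithinAt_iff_tendsto_slope' (by simp)] at d4
    have e : (Complex.exp (lam * (0:ℝ)) • -x + lam • (R x - ∫ τ in (0 : ℝ)..0,
        Complex.exp (-(lam * τ)) • Tsg.T τ x)) = -(x - lam • R x) := by
      simp; abel
    rw [e] at d4
    refine d4.congr' ?_
    filter_upwards [self_mem_nhdsWithin] with h hh
    rw [slope_def_module, RCLike.real_smul_eq_coe_smul (K := ℂ), hTR h (le_of_lt hh) x]
    simp
  refine ⟨R, ⟨fun x => (hgenR x).1, fun x => ?_, fun z => ?_⟩, hR, hRn⟩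
  · rw [(hgenR x).2]; simp
  · obtain ⟨h1, h2⟩ := gen_comm hgen hcomm z
    obtain ⟨h3, h4⟩ := hgenR z
    rw [h2] at h4
    rw [map_add, map_smul, h4]; simp

/-- Laplace transform of `τ ↦ τ T(τ) x`. -/
theorem laplace_mul (hgen : IsGenerator Tsg A) {K : ℝ} (hK : ∀ t : ℝ, 0 ≤ t → ‖Tsg.T t‖ ≤ K)
    (lam : ℂ) (hlam : 0 < lam.re) {R : X →L[ℂ] X} (hR : IsResolvent A lam R)
    (hRint : ∀ x, R x = ∫ τ in Ioi (0 : ℝ), Complex.exp (-(lam * τ)) • Tsg.T τ x) (x : X) :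
    ContinuousOn (fun τ : ℝ => (τ : ℂ) • Complex.exp (-(lam * τ)) • Tsg.T τ x) (Ici 0) ∧
    (∀ τ : ℝ, 0 < τ → ‖(τ : ℂ) • Complex.exp (-(lam * τ)) • Tsg.T τ x‖ ≤
      (2 / lam.re * (K * ‖x‖)) * Real.exp (-(lam.re / 2) * τ)) ∧
    ∫ τ in Ioi (0 : ℝ), (τ : ℂ) • Complex.exp (-(lam * τ)) • Tsg.T τ x = R (R x) := by
  have hK0 : 0 ≤ K := (norm_nonneg _).trans (hK 0 le_rfl)
  have hc : ∀ x, ContinuousOn (fun τ : ℝ => (τ : ℂ) • Complex.exp (-(lam * τ)) • Tsg.T τ x) (Ici 0) :=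
    fun x => ContinuousOn.smul (Continuous.continuousOn (by fun_prop)) (eorbit_cont Tsg lam x)
  have hb : ∀ x, ∀ τ : ℝ, 0 < τ → ‖(τ : ℂ) • Complex.exp (-(lam * τ)) • Tsg.T τ x‖ ≤
      (2 / lam.re * (K * ‖x‖)) * Real.exp (-(lam.re / 2) * τ) := by
    intro x τ hτ
    rw [norm_smul, Complex.norm_real, Real.norm_of_nonneg hτ.le]
    have h1 := eorbit_bound hK lam x hτ.le
    have h2 := mul_exp_le hlam hτ.le
    have h3 : 0 ≤ K * ‖x‖ := by positivity
    calc _ ≤ τ * ((K * ‖x‖) * Real.exp (-lam.re * τ)) := mul_le_mul_of_nonneg_left h1 hτ.le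
      _ = (K * ‖x‖) * (τ * Real.exp (-lam.re * τ)) := by ring
      _ ≤ (K * ‖x‖) * ((2 / lam.re) * Real.exp (-(lam.re / 2) * τ)) :=
        mul_le_mul_of_nonneg_left h2 h3
      _ = _ := by ring
  refine ⟨hc x, hb x, ?_⟩
  have hint1 : ∀ x, IntegrableOn (fun τ : ℝ => Complex.exp (-(lam * τ)) • Tsg.T τ x) (Ioi 0) :=
    fun x => expDecay_integrableOn (eorbit_cont Tsg lam x) hlam
      (fun τ hτ => eorbit_bound hK lam x (le_of_lt hτ))
  have hint2 : ∀ x, IntegrableOn (fun τ : ℝ => (τ : ℂ) • Complex.exp (-(lam * τ)) • Tsg.T τ x)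
      (Ioi 0) :=
    fun x => expDecay_integrableOn (hc x) (half_pos hlam) (hb x)
  set z : A.domain := ⟨R x, hR.mem_domain x⟩ with hz
  have hzx : lam • (z : X) + A z = x := hR.eq_apply x
  set G : ℝ → X := fun τ => Complex.exp (-(lam * τ)) • Tsg.T τ (z : X) -
    (τ : ℂ) • Complex.exp (-(lam * τ)) • Tsg.T τ x with hG
  have hGint : IntegrableOn G (Ioi 0) := (hint1 _).sub (hint2 x)
  have hftc : ∀ b : ℝ, 0 ≤ b → ∫ τ in (0:ℝ)..b, G τ =
      (b : ℂ) • Complex.exp (-(lam * b)) • Tsg.T b (z : X) := by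
    intro b hb0
    have := intervalIntegral.integral_eq_sub_of_hasDeriv_right_of_le (a := 0) (b := b) hb0
      (f := fun τ : ℝ => (τ : ℂ) • Complex.exp (-(lam * τ)) • Tsg.T τ (z : X)) (f' := G)
      ((hc z).mono Icc_subset_Ici_self) ?_ ?_
    · rw [this]; simp
    · intro τ hτ
      have d1 : HasDerivWithinAt (fun τ : ℝ => (τ : ℂ)) 1 (Ici τ) τ :=
        (Complex.ofRealCLM.hasDerivAt).hasDerivWithinAt
      have d2 := d1.smul (eorbit_deriv hgen lam z hτ.1.le)
      rw [hzx] at d2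
      have e : G τ = (τ : ℂ) • -(Complex.exp (-(lam * τ)) • Tsg.T τ x) +
        (1 : ℂ) • Complex.exp (-(lam * τ)) • Tsg.T τ (z : X) := by
        simp only [hG, smul_neg, one_smul]; abel
      rw [e]
      exact (d2.mono Ioi_subset_Ici_self)
    · rw [intervalIntegrable_iff_integrableOn_Ioc_of_le hb0]
      exact hGint.mono_set Ioc_subset_Ioi_self
  have ht1 := intervalIntegral_tendsto_integral_Ioi 0 hGint tendsto_id
  have ht2 : Tendsto (fun b : ℝ => ∫ τ in (0:ℝ)..b, G τ) atTop (𝓝 0) := by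
    have hlim : Tendsto (fun b : ℝ => (2 / lam.re * (K * ‖(z : X)‖)) * Real.exp (-(lam.re / 2) * b))
        atTop (𝓝 0) := by
      rw [← mul_zero (2 / lam.re * (K * ‖(z : X)‖))]
      refine Tendsto.const_mul _ (Real.tendsto_exp_atBot.comp ?_)
      exact tendsto_id.const_mul_atTop_of_neg (by linarith)
    refine squeeze_zero_norm' ?_ hlim
    filter_upwards [eventually_gt_atTop 0] with b hb0
    rw [hftc b hb0.le]
    exact hb z b hb0
  have h0 := tendsto_nhds_unique ht1 ht2
  rw [hG, integral_sub (hint1 _) (hint2 x), ← hRint, sub_eq_zero] at h0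
  exact h0.symm
end Lap

open Filter MeasureTheory Set Complex Asymptotics

/-! ### Decay from resolvent bounds (Hilbert space) -/
section Decay
open scoped Topology FourierTransform

variable {X : Type*} [NormedAddCommGroup X] [InnerProductSpace ℂ X] [CompleteSpace X]
  {Tsg : C0Semigroup X} {A : X →ₗ.[ℂ] X}

theorem decay_pointwise (hgen : IsGenerator Tsg A) {K : ℝ}
    (hK : ∀ t : ℝ, 0 ≤ t → ‖Tsg.T t‖ ≤ K) {Res : ℝ → X →L[ℂ] X}
    (hRes : ∀ s : ℝ, s ≠ 0 → IsResolvent A (Complex.I * (s : ℂ)) (Res s))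
    {Y : X →L[ℂ] X} (hY : ∀ t : ℝ, 0 ≤ t → ∀ x, Y (Tsg.T t x) = Tsg.T t (Y x))
    {M : ℝ} (hM : ∀ s : ℝ, s ≠ 0 → ‖Res s ∘L Y‖ ≤ M) {t : ℝ} (ht : 0 < t) (x : X) :
    ‖Tsg.T t (Y x)‖ ≤ (2 * Real.exp 1 * K ^ 2 * (1 + K)) * M / t * ‖x‖ := by
  have hK0 : 0 ≤ K := (norm_nonneg _).trans (hK 0 le_rfl)
  have hM0 : 0 ≤ M := (norm_nonneg _).trans (hM 1 one_ne_zero)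
  set σ : ℝ := t⁻¹ with hσ
  have hσ0 : 0 < σ := inv_pos.2 ht
  set F : ℝ → X := fun τ => Complex.exp (-((σ : ℂ) * τ)) • Tsg.T τ x with hF
  set U : ℝ → X := fun τ => (τ : ℂ) • Complex.exp (-((σ : ℂ) * τ)) • Tsg.T τ (Y x) with hU
  have hFc : ContinuousOn F (Ici 0) := eorbit_cont Tsg _ x
  have hFb : ∀ τ : ℝ, 0 < τ → ‖F τ‖ ≤ (K * ‖x‖) * Real.exp (-σ * τ) := fun τ hτ => by
    simpa using eorbit_bound hK (σ : ℂ) x hτ.le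
  obtain ⟨R0, hR0, hR0i, -⟩ := exists_laplace hgen hK (σ : ℂ) (by simpa using hσ0)
  obtain ⟨hUc, hUb, -⟩ := laplace_mul hgen hK (σ : ℂ) (by simpa using hσ0) hR0 hR0i (Y x)
  simp only [Complex.ofReal_re] at hUb
  obtain ⟨f1, f2⟩ := expDecay_indicator hFc hσ0 hFb
  obtain ⟨u1, u2⟩ := expDecay_indicator hUc (half_pos hσ0) hUb
  have key := my_multiplier _ _ f1 f2 u1 u2 (M * (1 + K)) (by positivity) ?_
  · have nind : ∀ w : ℝ → X, ∫ τ, ‖(Ioi 0).indicator w τ‖ ^ 2 = ∫ τ in Ioi 0, ‖w τ‖ ^ 2 := by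
      intro w
      rw [← integral_indicator measurableSet_Ioi]
      congr 1
      ext τ
      by_cases h : τ ∈ Ioi (0 : ℝ) <;> simp [h, indicator]
    rw [nind, nind] at key
    have hF2 := (expDecay_sq hFc hσ0 hFb).2
    have hU1 := (expDecay_sq hUc (half_pos hσ0) hUb).1
    set N := ‖Tsg.T t (Y x)‖ with hN
    have hlow : ∀ τ ∈ Ioc (t / 2) t, ((t / 2) * Real.exp (-1) * N) ^ 2 ≤ K ^ 2 * ‖U τ‖ ^ 2 := by
      intro τ hτ
      have hτ0 : 0 < τ := by have := hτ.1; linarith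
      have hτt : 0 ≤ t - τ := sub_nonneg.2 hτ.2
      have e : Tsg.T t = Tsg.T (t - τ) ∘L Tsg.T τ := by
        rw [← Tsg.map_add _ _ hτt hτ0.le]; simp
      have h1 : N ≤ K * ‖Tsg.T τ (Y x)‖ := by
        rw [hN, e]
        exact (Tsg.T (t - τ)).le_of_opNorm_le (hK _ hτt) _
      have h2 : ‖U τ‖ = τ * (Real.exp (-σ * τ) * ‖Tsg.T τ (Y x)‖) := by
        rw [hU]; simp only
        rw [norm_smul, norm_smul, norm_cexp, Complex.norm_real, Real.norm_of_nonneg hτ0.le]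
        simp
      have h3 : Real.exp (-1) ≤ Real.exp (-σ * τ) := by
        apply Real.exp_le_exp.2
        have : σ * τ ≤ σ * t := mul_le_mul_of_nonneg_left hτ.2 hσ0.le
        rw [hσ, inv_mul_cancel₀ ht.ne'] at this
        rw [hσ]; linarith
      rw [← mul_pow]
      apply pow_le_pow_left₀ (by positivity)
      rw [h2]
      calc t / 2 * Real.exp (-1) * N ≤ τ * Real.exp (-σ * τ) * (K * ‖Tsg.T τ (Y x)‖) := by
            gcongr
            exact hτ.1.le
        _ = _ := by ring
    have hint : (t / 2) * ((t / 2) * Real.exp (-1) * N) ^ 2 ≤ K ^ 2 * ∫ τ in Ioi 0, ‖U τ‖ ^ 2 := by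
      rw [← integral_const_mul]
      have hsub : Ioc (t / 2) t ⊆ Ioi (0:ℝ) := fun τ hτ => by
        have := hτ.1; simp only [mem_Ioi]; linarith
      have hU2 : IntegrableOn (fun τ => K ^ 2 * ‖U τ‖ ^ 2) (Ioi 0) := hU1.const_mul _
      calc _ = ∫ τ in Ioc (t / 2) t, ((t / 2) * Real.exp (-1) * N) ^ 2 := by
            rw [setIntegral_const, smul_eq_mul]
            simp only [measureReal_def, Real.volume_Ioc]
            rw [ENNReal.toReal_ofReal (by linarith)]
            ring
        _ ≤ ∫ τ in Ioc (t / 2) t, K ^ 2 * ‖U τ‖ ^ 2 := by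
            refine setIntegral_mono_on ?_ (hU2.mono_set hsub) measurableSet_Ioc hlow
            exact integrableOn_const (by simp) 
        _ ≤ _ := setIntegral_mono_set hU2 (Eventually.of_forall fun τ => by positivity)
            (LE.le.eventuallyLE hsub)
    have h4 : (t / 2) * ((t / 2) * Real.exp (-1) * N) ^ 2 ≤
        K ^ 2 * ((M * (1 + K)) ^ 2 * ((K * ‖x‖) ^ 2 / (2 * σ))) :=
      hint.trans (mul_le_mul_of_nonneg_left (key.trans (mul_le_mul_of_nonneg_left hF2 (by positivity)))
        (by positivity))
    have h5 : ((t / 2) * Real.exp (-1) * N) ^ 2 ≤ (K * (M * (1 + K)) * (K * ‖x‖)) ^ 2 := by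
      have e : K ^ 2 * ((M * (1 + K)) ^ 2 * ((K * ‖x‖) ^ 2 / (2 * σ))) =
          (t / 2) * (K * (M * (1 + K)) * (K * ‖x‖)) ^ 2 := by
        rw [hσ]; field_simp
      rw [e] at h4
      exact le_of_mul_le_mul_left h4 (by positivity)
    have h6 := (pow_le_pow_iff_left₀ (by positivity) (by positivity) two_ne_zero).1 h5
    have h7 : Real.exp 1 * Real.exp (-1) = 1 := by rw [← Real.exp_add]; simp
    rw [div_mul_eq_mul_div, le_div_iff₀ ht]
    calc N * t = 2 * Real.exp 1 * (t / 2 * Real.exp (-1) * N) := by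
          linear_combination (-(N * t)) * h7
      _ ≤ 2 * Real.exp 1 * (K * (M * (1 + K)) * (K * ‖x‖)) := by gcongr
      _ = _ := by ring
  · intro ξ hξ
    set s : ℝ := 2 * Real.pi * ξ with hs
    have hs0 : s ≠ 0 := by rw [hs]; positivity
    set lam : ℂ := (σ : ℂ) + Complex.I * s with hlam
    have hlre : lam.re = σ := by simp [hlam]
    have hl0 : 0 < lam.re := by rw [hlre]; exact hσ0
    obtain ⟨R, hR, hRi, hRn⟩ := exists_laplace hgen hK lam hl0
    obtain ⟨-, -, hR2⟩ := laplace_mul hgen hK lam hl0 hR hRi (Y x)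
    have hexp : ∀ τ : ℝ, Complex.exp (-(lam * τ)) =
        Complex.exp (((-2 * Real.pi * (inner ℝ τ ξ : ℝ) : ℝ) : ℂ) * Complex.I) * Complex.exp (-((σ : ℂ) * τ)) := by
      intro τ
      rw [← Complex.exp_add, hlam, hs]
      congr 1
      simp
      ring
    have eF : (𝓕 ((Ioi 0).indicator F) : ℝ → X) ξ = R x := by
      rw [Real.fourier_eq', hRi x, ← integral_indicator measurableSet_Ioi]
      congr 1
      ext τ
      by_cases h : τ ∈ Ioi (0 : ℝ)
      · simp only [h, indicator_of_mem, hF]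
        rw [hexp, mul_smul]
      · simp only [h, indicator_of_notMem, not_false_eq_true, smul_zero]
    have eU : (𝓕 ((Ioi 0).indicator U) : ℝ → X) ξ = R (R (Y x)) := by
      rw [Real.fourier_eq', ← hR2, ← integral_indicator measurableSet_Ioi]
      congr 1
      ext τ
      by_cases h : τ ∈ Ioi (0 : ℝ)
      · simp only [h, indicator_of_mem, hU]
        rw [hexp, mul_smul]
        exact smul_comm _ _ _
      · simp only [h, indicator_of_notMem, not_false_eq_true, smul_zero]
    rw [eF, eU]
    have hRY : ∀ y, R (Y y) = Y (R y) := by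
      intro y
      have hint : IntegrableOn (fun τ : ℝ => Complex.exp (-(lam * τ)) • Tsg.T τ y) (Ioi 0) :=
        expDecay_integrableOn (eorbit_cont Tsg lam y) hl0
          (fun τ hτ => eorbit_bound hK lam y (le_of_lt hτ))
      rw [hRi, hRi, ← ContinuousLinearMap.integral_comp_comm _ hint]
      refine setIntegral_congr_fun measurableSet_Ioi fun τ hτ => ?_
      simp only [map_smul]
      rw [hY τ (le_of_lt hτ)]
    have e1 : R (R (Y x)) = (Res s ∘L Y) (R x - (σ : ℂ) • R (R x)) := by
      have h1 := resolvent_identity (hRes s hs0) hR (Y (R x))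
      rw [hRY x, h1, ContinuousLinearMap.comp_apply, map_sub, map_sub, map_smul, map_smul,
        ← hRY (R x), hlam]
      module
    rw [e1]
    have h2 : ‖(σ : ℂ) • R (R x)‖ ≤ K * ‖R x‖ := by
      rw [norm_smul, Complex.norm_real, Real.norm_of_nonneg hσ0.le]
      have := R.le_of_opNorm_le hRn (R x)
      rw [hlre] at this
      calc σ * ‖R (R x)‖ ≤ σ * (K / σ * ‖R x‖) := mul_le_mul_of_nonneg_left this hσ0.le
        _ = K * ‖R x‖ := by field_simp
    calc _ ≤ M * ‖R x - (σ : ℂ) • R (R x)‖ := (Res s ∘L Y).le_of_opNorm_le (hM s hs0) _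
      _ ≤ M * (‖R x‖ + K * ‖R x‖) := by
        gcongr
        exact (norm_sub_le _ _).trans (by gcongr)
      _ = _ := by ring

theorem decay_of_bound (hgen : IsGenerator Tsg A) {K : ℝ}
    (hK : ∀ t : ℝ, 0 ≤ t → ‖Tsg.T t‖ ≤ K) {Res : ℝ → X →L[ℂ] X}
    (hRes : ∀ s : ℝ, s ≠ 0 → IsResolvent A (Complex.I * (s : ℂ)) (Res s))
    {Y : X →L[ℂ] X} (hY : ∀ t : ℝ, 0 ≤ t → ∀ x, Y (Tsg.T t x) = Tsg.T t (Y x))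
    {M : ℝ} (hM : ∀ s : ℝ, s ≠ 0 → ‖Res s ∘L Y‖ ≤ M) {t : ℝ} (ht : 0 < t) :
    ‖Tsg.T t ∘L Y‖ ≤ (2 * Real.exp 1 * K ^ 2 * (1 + K)) * M / t := by
  have hK0 : 0 ≤ K := (norm_nonneg _).trans (hK 0 le_rfl)
  have hM0 : 0 ≤ M := (norm_nonneg _).trans (hM 1 one_ne_zero)
  exact ContinuousLinearMap.opNorm_le_bound _ (by positivity)
    fun x => decay_pointwise hgen hK hRes hY hM ht x
end Decay

open Filter MeasureTheory Set Complex Asymptotics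

/-! ### Sectorial bounded operators and approximate eigenvectors -/
section Sect
open scoped Topology

theorem bmin_integral {γ b : ℝ} (h0 : 0 < γ) (h1 : γ < 1) (hb : 0 < b) :
    IntegrableOn (fun t : ℝ => t ^ (γ - 1) * min 1 (b / t)) (Ioi 0) ∧
      ∫ t in Ioi (0:ℝ), t ^ (γ - 1) * min 1 (b / t) = b ^ γ * (1 / γ + 1 / (1 - γ)) := by
  have e1 : ∀ t ∈ Ioc 0 b, t ^ (γ - 1) * min 1 (b / t) = t ^ (γ - 1) := by
    intro t ht
    rw [min_eq_left, mul_one]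
    rw [le_div_iff₀ ht.1]; linarith [ht.2]
  have e2 : ∀ t ∈ Ioi b, t ^ (γ - 1) * min 1 (b / t) = b * t ^ (γ - 2) := by
    intro t ht
    have ht' : b < t := ht
    have ht0 : 0 < t := hb.trans ht'
    rw [min_eq_right, show γ - 2 = (γ - 1) - 1 by ring, Real.rpow_sub_one ht0.ne' (γ - 1)]
    · ring
    · rw [div_le_one ht0]; linarith
  have i1 : IntegrableOn (fun t : ℝ => t ^ (γ - 1)) (Ioc 0 b) := by
    rw [← intervalIntegrable_iff_integrableOn_Ioc_of_le hb.le]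
    exact intervalIntegral.intervalIntegrable_rpow' (by linarith)
  have i2 : IntegrableOn (fun t : ℝ => b * t ^ (γ - 2)) (Ioi b) :=
    (integrableOn_Ioi_rpow_of_lt (by linarith) hb).const_mul b
  have j1 := i1.congr_fun (fun t ht => (e1 t ht).symm) measurableSet_Ioc
  have j2 := i2.congr_fun (fun t ht => (e2 t ht).symm) measurableSet_Ioi
  rw [← Ioc_union_Ioi_eq_Ioi hb.le]
  refine ⟨j1.union j2, ?_⟩
  rw [setIntegral_union (Ioc_disjoint_Ioi le_rfl) measurableSet_Ioi j1 j2,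
    setIntegral_congr_fun measurableSet_Ioc e1, setIntegral_congr_fun measurableSet_Ioi e2,
    integral_const_mul, integral_Ioi_rpow_of_lt (by linarith) hb,
    ← intervalIntegral.integral_of_le hb.le, integral_rpow (Or.inl (by linarith))]
  have h2 : b ^ (γ - 2 + 1) = b ^ γ / b := by
    rw [← Real.rpow_sub_one hb.ne']; congr 1; ring
  rw [h2, show γ - 1 + 1 = γ by ring, Real.zero_rpow h0.ne']
  have : 1 - γ ≠ 0 := by linarith
  have : γ - 2 + 1 ≠ 0 := by linarith
  field_simp
  ring

variable {X : Type*} [NormedAddCommGroup X] [NormedSpace ℂ X]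

/-- sectoriality of a bounded operator with constant `M` -/
def Sectl (B : X →L[ℂ] X) (M : ℝ) : Prop :=
  ∀ t : ℝ, 0 < t → IsUnit ((t : ℂ) • (1 : X →L[ℂ] X) + B) ∧
    ‖Ring.inverse ((t : ℂ) • (1 : X →L[ℂ] X) + B)‖ ≤ M / t

/-- abbreviation for `(t + B)⁻¹` -/
noncomputable def Sinv (B : X →L[ℂ] X) (t : ℝ) : X →L[ℂ] X :=
  Ring.inverse ((t : ℂ) • (1 : X →L[ℂ] X) + B)

variable {B : X →L[ℂ] X} {M : ℝ}

theorem Sectl.inv_norm (h : Sectl B M) {t : ℝ} (ht : 0 < t) : ‖Sinv B t‖ ≤ M / t := (h t ht).2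

theorem Sectl.nonneg (h : Sectl B M) : 0 ≤ M := by
  have := (norm_nonneg _).trans (h.inv_norm one_pos)
  simpa using this

theorem Sectl.left (h : Sectl B M) {t : ℝ} (ht : 0 < t) (x : X) :
    Sinv B t ((t : ℂ) • x + B x) = x := by
  have := Ring.inverse_mul_cancel _ (h t ht).1
  exact congrArg (fun L => L x) this

theorem Sectl.right (h : Sectl B M) {t : ℝ} (ht : 0 < t) (x : X) :
    (t : ℂ) • Sinv B t x + B (Sinv B t x) = x := by
  have := Ring.mul_inverse_cancel _ (h t ht).1
  exact congrArg (fun L => L x) this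

theorem Sectl.commute (h : Sectl B M) {L : X →L[ℂ] X} (hL : Commute L B) {t : ℝ} (ht : 0 < t) :
    Commute L (Sinv B t) := by
  have h1 : Commute L ((t : ℂ) • (1 : X →L[ℂ] X) + B) :=
    Commute.add_right ((Commute.one_right L).smul_right _) hL
  obtain ⟨u, hu⟩ := (h t ht).1
  rw [Sinv, ← hu, Ring.inverse_unit]
  rw [← hu] at h1
  exact h1.units_inv_right

theorem Sectl.mul_inv (h : Sectl B M) {t : ℝ} (ht : 0 < t) :
    B * Sinv B t = 1 - (t : ℂ) • Sinv B t := by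
  ext x
  have := h.right ht x
  simp only [ContinuousLinearMap.mul_apply, ContinuousLinearMap.sub_apply,
    ContinuousLinearMap.one_apply, ContinuousLinearMap.smul_apply]
  exact eq_sub_of_add_eq' this

theorem Sectl.mul_norm1 (h : Sectl B M) {t : ℝ} (ht : 0 < t) : ‖B * Sinv B t‖ ≤ 1 + M := by
  rw [h.mul_inv ht]
  refine (norm_sub_le _ _).trans (add_le_add ContinuousLinearMap.norm_id_le ?_)
  rw [norm_smul, Complex.norm_real, Real.norm_of_nonneg ht.le]
  calc t * ‖Sinv B t‖ ≤ t * (M / t) := mul_le_mul_of_nonneg_left (h.inv_norm ht) ht.le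
    _ = M := by field_simp

theorem Sectl.mul_norm2 (h : Sectl B M) {t : ℝ} (ht : 0 < t) : ‖B * Sinv B t‖ ≤ ‖B‖ * M / t := by
  refine (norm_mul_le _ _).trans ?_
  rw [mul_div_assoc]
  exact mul_le_mul_of_nonneg_left (h.inv_norm ht) (norm_nonneg _)

theorem Sectl.mul_norm (h : Sectl B M) {t : ℝ} (ht : 0 < t) :
    ‖B * Sinv B t‖ ≤ (1 + M + ‖B‖ * M) * min 1 (1 / t) := by
  have hM := h.nonneg
  rcases min_cases 1 (1 / t) with ⟨e, _⟩ | ⟨e, _⟩ <;> rw [e]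
  · refine (h.mul_norm1 ht).trans ?_
    have : 0 ≤ ‖B‖ * M := by positivity
    linarith
  · refine (h.mul_norm2 ht).trans ?_
    rw [mul_one_div]
    gcongr
    linarith

theorem abs_add_ge {t : ℝ} (ht : 0 < t) {β : ℂ} (hβ : 0 ≤ β.re) :
    t ≤ ‖(t : ℂ) + β‖ ∧ ‖β‖ ≤ ‖(t : ℂ) + β‖ := by
  constructor
  · have := Complex.re_le_norm ((t : ℂ) + β)
    simp at this; linarith
  · rw [← sq_le_sq₀ (norm_nonneg _) (norm_nonneg _), Complex.sq_norm, Complex.sq_norm,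
      Complex.normSq_apply, Complex.normSq_apply]
    simp
    nlinarith

theorem symb_bound {t : ℝ} (ht : 0 < t) {β : ℂ} (hβ : 0 ≤ β.re) :
    ‖β / (t + β)‖ ≤ min 1 (‖β‖ / t) := by
  obtain ⟨h1, h2⟩ := abs_add_ge ht hβ
  have h3 : 0 < ‖(t : ℂ) + β‖ := ht.trans_le h1
  rw [norm_div]
  refine le_min ?_ ?_
  · rw [div_le_one h3]; exact h2
  · gcongr

theorem symb_re {t : ℝ} (ht : 0 < t) {β : ℂ} (hβ : 0 ≤ β.re) :
    0 ≤ (β / (t + β)).re ∧ (t ≤ ‖β‖ → 1 / 4 ≤ (β / (t + β)).re) := by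
  obtain ⟨h1, h2⟩ := abs_add_ge ht hβ
  have h3 : 0 < ‖(t : ℂ) + β‖ := ht.trans_le h1
  have hn : 0 < Complex.normSq ((t : ℂ) + β) := by
    rw [← Complex.sq_norm]; positivity
  have e : (β / (t + β)).re = (t * β.re + ‖β‖ ^ 2) / Complex.normSq ((t : ℂ) + β) := by
    rw [Complex.div_re, Complex.sq_norm, Complex.normSq_apply β]
    simp
    ring
  rw [e]
  constructor
  · positivity
  · intro htb
    rw [le_div_iff₀ hn, ← Complex.sq_norm]
    have h4 : ‖(t : ℂ) + β‖ ≤ t + ‖β‖ := by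
      refine (norm_add_le _ _).trans ?_
      rw [Complex.norm_real, Real.norm_of_nonneg ht.le]
    have h5 : ‖(t : ℂ) + β‖ ^ 2 ≤ (2 * ‖β‖) ^ 2 := by
      apply pow_le_pow_left₀ (norm_nonneg _); linarith
    have : 0 ≤ t * β.re := by positivity
    nlinarith

theorem Sectl.symb (h : Sectl B M) {t : ℝ} (ht : 0 < t) {β : ℂ} (hβ : 0 ≤ β.re) {x w : X}
    (hx : B x = β • x + w) :
    (B * Sinv B t) x = (β / (t + β)) • x + ((t : ℂ) / (t + β)) • Sinv B t w := by
  obtain ⟨h1, h2⟩ := abs_add_ge ht hβ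
  have h3 : (t : ℂ) + β ≠ 0 := by
    intro h0; rw [h0] at h1; simp at h1; linarith
  have h4 := h.left ht x
  rw [hx, ← add_assoc, ← add_smul, map_add, map_smul] at h4
  have h5 : Sinv B t x = ((t : ℂ) + β)⁻¹ • (x - Sinv B t w) := by
    rw [eq_inv_smul_iff₀ h3]; exact eq_sub_of_add_eq h4
  rw [h.mul_inv ht]
  simp only [ContinuousLinearMap.sub_apply, ContinuousLinearMap.one_apply,
    ContinuousLinearMap.smul_apply]
  rw [h5]
  have e : β / (t + β) = 1 - (t : ℂ) * ((t : ℂ) + β)⁻¹ := by field_simp; ring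
  rw [e, div_eq_mul_inv]
  module

/-- powers of `B` -/
theorem symb_pow (B : X →L[ℂ] X) (n : ℕ) : ∃ C : ℝ, 0 ≤ C ∧ ∀ (β : ℂ) (x w : X), ‖β‖ ≤ 1 →
    B x = β • x + w → ‖(B ^ n) x - β ^ n • x‖ ≤ C * ‖w‖ := by
  induction n with
  | zero => exact ⟨0, le_rfl, fun β x w _ _ => by simp⟩
  | succ n ih =>
    obtain ⟨C, hC, h⟩ := ih
    refine ⟨C + ‖B ^ n‖, by positivity, fun β x w hβ hx => ?_⟩
    have e : (B ^ (n + 1)) x - β ^ (n + 1) • x = β • ((B ^ n) x - β ^ n • x) + (B ^ n) w := by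
      rw [pow_succ, ContinuousLinearMap.mul_apply, hx, map_add, map_smul, pow_succ]
      module
    rw [e]
    have h1 := h β x w hβ hx
    have h2 := (B ^ n).le_opNorm w
    calc _ ≤ ‖β‖ * ‖(B ^ n) x - β ^ n • x‖ + ‖(B ^ n) w‖ := by
          rw [← norm_smul]; exact norm_add_le _ _
      _ ≤ 1 * (C * ‖w‖) + ‖B ^ n‖ * ‖w‖ := by gcongr
      _ = _ := by ring

theorem symb_P_aux (P : X →L[ℂ] X) (β p : ℂ) (x q : X) (e1 : P x = p • x + q) (m : ℕ) :
    β • (P ^ (m + 1)) x - (β * p ^ (m + 1)) • x =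
          p • (β • (P ^ m) x - (β * p ^ m) • x) + (P ^ m) (β • q) := by
  have h : (P ^ (m + 1)) x = p • (P ^ m) x + (P ^ m) q := by
    rw [pow_succ P, ContinuousLinearMap.mul_apply, e1, map_add, map_smul]
  rw [h, map_smul, pow_succ]
  module

theorem Sectl.symb_P (h : Sectl B M) (m : ℕ) : ∃ C : ℝ, 0 ≤ C ∧ ∀ (ε : ℝ) (β : ℂ) (x w : X), 0 < ε →
    0 ≤ β.re → B x = β • x + w →
    ‖(B * (B * Sinv B ε) ^ m) x - (β * (β / (ε + β)) ^ m) • x‖ ≤ C * ‖w‖ := by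
  have hM := h.nonneg
  have main : ∃ C : ℝ, 0 ≤ C ∧ ∀ (ε : ℝ) (β : ℂ) (x w : X), 0 < ε →
    0 ≤ β.re → B x = β • x + w →
    ‖β • ((B * Sinv B ε) ^ m) x - (β * (β / (ε + β)) ^ m) • x‖ ≤ C * ‖w‖ := by
    induction m with
    | zero => exact ⟨0, le_rfl, fun ε β x w _ _ _ => by simp⟩
    | succ m ih =>
      obtain ⟨C, hC, hh⟩ := ih
      refine ⟨C + (1 + M) ^ m * M, by positivity, fun ε β x w hε hβ hx => ?_⟩
      have e1 := h.symb hε hβ hx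
      set P := B * Sinv B ε with hP
      set p := β / (ε + β) with hp
      set q := ((ε : ℂ) / (ε + β)) • Sinv B ε w with hq
      have e : β • (P ^ (m + 1)) x - (β * p ^ (m + 1)) • x =
          p • (β • (P ^ m) x - (β * p ^ m) • x) + (P ^ m) (β • q) := by
        exact symb_P_aux P β p x q e1 m
      have h1 := hh ε β x w hε hβ hx
      have hp1 : ‖p‖ ≤ 1 := (symb_bound hε hβ).trans (min_le_left _ _)
      have hPm : ‖P ^ m‖ ≤ (1 + M) ^ m := by
        rcases m.eq_zero_or_pos with rfl | hm
        · rw [pow_zero, pow_zero]; exact ContinuousLinearMap.norm_id_le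
        · exact (norm_pow_le' P hm).trans (pow_le_pow_left₀ (norm_nonneg _) (h.mul_norm1 hε) m)
      have hq1 : ‖β • q‖ ≤ M * ‖w‖ := by
        rw [hq, smul_smul, show β * ((ε : ℂ) / (ε + β)) = p * ε by rw [hp]; ring, mul_smul,
          norm_smul, norm_smul, Complex.norm_real, Real.norm_of_nonneg hε.le]
        have := (Sinv B ε).le_of_opNorm_le (h.inv_norm hε) w
        calc _ ≤ 1 * (ε * (M / ε * ‖w‖)) := by gcongr
          _ = M * ‖w‖ := by field_simp
      rw [e]
      calc _ ≤ ‖p‖ * ‖β • (P ^ m) x - (β * p ^ m) • x‖ + ‖P ^ m‖ * ‖β • q‖ := by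
            refine (norm_add_le _ _).trans (add_le_add (norm_smul_le _ _) ((P ^ m).le_opNorm _))
        _ ≤ 1 * (C * ‖w‖) + (1 + M) ^ m * (M * ‖w‖) := by gcongr
        _ = _ := by ring
  obtain ⟨C, hC, hh⟩ := main
  refine ⟨C + (1 + M) ^ m, by positivity, fun ε β x w hε hβ hx => ?_⟩
  have hc : Commute B ((B * Sinv B ε) ^ m) :=
    (((Commute.refl B).mul_right (h.commute (Commute.refl B) hε)).pow_right m)
  have hPm : ‖(B * Sinv B ε) ^ m‖ ≤ (1 + M) ^ m := by
    rcases m.eq_zero_or_pos with rfl | hm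
    · rw [pow_zero, pow_zero]; exact ContinuousLinearMap.norm_id_le
    · exact (norm_pow_le' _ hm).trans (pow_le_pow_left₀ (norm_nonneg _) (h.mul_norm1 hε) m)
  rw [hc.eq, ContinuousLinearMap.mul_apply, hx, map_add, map_smul, add_sub_right_comm]
  refine (norm_add_le _ _).trans ?_
  rw [add_mul]
  exact add_le_add (hh ε β x w hε hβ hx) (((B * Sinv B ε) ^ m).le_of_opNorm_le hPm w)

theorem Sectl.one_sub_P (h : Sectl B M) (m : ℕ) : ∃ C : ℝ, 0 ≤ C ∧ ∀ ε : ℝ, 0 < ε →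
    ‖B - B * (B * Sinv B ε) ^ m‖ ≤ C * ε := by
  have hM := h.nonneg
  induction m with
  | zero => exact ⟨0, le_rfl, fun ε _ => by simp⟩
  | succ m ih =>
    obtain ⟨C, hC, hh⟩ := ih
    refine ⟨C * (1 + M) + (1 + M), by positivity, fun ε hε => ?_⟩
    have e : B - B * (B * Sinv B ε) ^ (m + 1) =
        (B - B * (B * Sinv B ε) ^ m) * (B * Sinv B ε) + (ε : ℂ) • (B * Sinv B ε) := by
      have e1 : (ε : ℂ) • (B * Sinv B ε) = B - B * (B * Sinv B ε) := by
        conv_rhs => rw [h.mul_inv hε]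
        rw [mul_sub, mul_one, mul_smul_comm]; abel
      rw [e1, sub_mul, mul_assoc B ((B * Sinv B ε) ^ m), ← pow_succ]
      abel
    rw [e]
    have h1 := h.mul_norm1 hε
    calc _ ≤ ‖B - B * (B * Sinv B ε) ^ m‖ * ‖B * Sinv B ε‖ + ‖(ε : ℂ)‖ * ‖B * Sinv B ε‖ :=
          (norm_add_le _ _).trans (add_le_add (norm_mul_le _ _) (norm_smul_le _ _))
      _ ≤ (C * ε) * (1 + M) + ε * (1 + M) := by
          rw [Complex.norm_real, Real.norm_of_nonneg hε.le]
          gcongr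
          exact hh ε hε
      _ = _ := by ring
end Sect

open Filter MeasureTheory Set Complex Asymptotics

section Bal
open scoped Topology
variable {X : Type*} [NormedAddCommGroup X] [NormedSpace ℂ X] [CompleteSpace X]
variable {B : X →L[ℂ] X} {M : ℝ}

theorem Sectl.continuousOn (h : Sectl B M) : ContinuousOn (fun t : ℝ => Sinv B t) (Ioi 0) := by
  intro t ht
  apply ContinuousAt.continuousWithinAt
  obtain ⟨u, hu⟩ := (h t ht).1
  have h1 := NormedRing.inverse_continuousAt u
  rw [hu] at h1
  have h2 : ContinuousAt (fun t : ℝ => (t : ℂ) • (1 : X →L[ℂ] X) + B) t := by fun_prop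
  exact ContinuousAt.comp (f := fun t : ℝ => (t : ℂ) • (1 : X →L[ℂ] X) + B) h1 h2

theorem kpow_continuousOn (γ : ℝ) : ContinuousOn (fun t : ℝ => t ^ (γ - 1)) (Ioi 0) := by
  intro t ht
  exact (Real.continuousAt_rpow_const t _ (Or.inl (ne_of_gt ht))).continuousWithinAt

theorem Sectl.integrand_bound (h : Sectl B M) (γ : ℝ) {t : ℝ} (ht : 0 < t) :
    ‖(t ^ (γ - 1) : ℝ) • (B * Sinv B t)‖ ≤
      (1 + M + ‖B‖ * M) * (t ^ (γ - 1) * min 1 (1 / t)) := by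
  have h0 : 0 ≤ t ^ (γ - 1) := Real.rpow_nonneg ht.le _
  rw [norm_smul, Real.norm_of_nonneg h0]
  calc _ ≤ t ^ (γ - 1) * ((1 + M + ‖B‖ * M) * min 1 (1 / t)) := by
        gcongr; exact h.mul_norm ht
    _ = _ := by ring

theorem Sectl.integrable (h : Sectl B M) {γ : ℝ} (h0 : 0 < γ) (h1 : γ < 1) :
    IntegrableOn (fun t : ℝ => (t ^ (γ - 1) : ℝ) • (B * Sinv B t)) (Ioi 0) := by
  refine Integrable.mono' ((bmin_integral h0 h1 one_pos).1.const_mul (1 + M + ‖B‖ * M)) ?_ ?_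
  · exact ((kpow_continuousOn γ).smul (continuousOn_const.mul h.continuousOn)).aestronglyMeasurable
      measurableSet_Ioi
  · exact (ae_restrict_iff' measurableSet_Ioi).2 (Eventually.of_forall
      fun t ht => h.integrand_bound γ ht)

theorem Sectl.bal_commute (h : Sectl B M) {γ : ℝ} (h0 : 0 < γ) (h1 : γ < 1)
    {L : X →L[ℂ] X} (hL : Commute L B) : Commute L (balakrishnan B γ) := by
  have hi := h.integrable h0 h1
  have key : L * (∫ t in Ioi (0:ℝ), (t ^ (γ - 1) : ℝ) • (B * Sinv B t)) =
      (∫ t in Ioi (0:ℝ), (t ^ (γ - 1) : ℝ) • (B * Sinv B t)) * L := by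
    rw [← integral_const_mul_of_integrable hi, ← integral_mul_const_of_integrable hi]
    refine setIntegral_congr_fun measurableSet_Ioi fun t ht => ?_
    have := (hL.mul_right (h.commute hL ht)).eq
    simp only [mul_smul_comm, smul_mul_assoc]
    rw [this]
  unfold balakrishnan
  exact Commute.smul_right key _

theorem Sectl.symb_bal (h : Sectl B M) {γ : ℝ} (h0 : 0 < γ) (h1 : γ < 1) :
    ∃ C c : ℝ, 0 ≤ C ∧ 0 < c ∧ ∀ (β : ℂ) (x w : X), 0 ≤ β.re → 0 < ‖β‖ → ‖β‖ ≤ 1 →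
      B x = β • x + w → ∃ g : ℂ, c * ‖β‖ ^ γ ≤ ‖g‖ ∧ ‖g‖ ≤ C * ‖β‖ ^ γ ∧
        ‖(B * balakrishnan B γ) x - (g * β) • x‖ ≤ C * ‖w‖ := by
  have hM := h.nonneg
  set c0 : ℝ := Real.sin (Real.pi * γ) / Real.pi with hc0
  have hc : 0 < c0 := by
    apply div_pos _ Real.pi_pos
    apply Real.sin_pos_of_pos_of_lt_pi
    · positivity
    · nlinarith [Real.pi_pos]
  set D := 1 + M + ‖B‖ * M with hD
  set E := 1 / γ + 1 / (1 - γ) with hE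
  have hE0 : 0 ≤ E := by
    have : 0 < 1 - γ := by linarith
    positivity
  have hD0 : 0 ≤ D := by positivity
  refine ⟨c0 * E + c0 * (D * E), c0 * (1 / (4 * γ)), by positivity, by positivity,
    fun β x w hβ hβ0 hβ1 hx => ?_⟩
  have hi := h.integrable h0 h1
  -- the scalar integrand
  set f : ℝ → ℂ := fun t => (t ^ (γ - 1) : ℝ) • (β / (t + β)) with hf
  obtain ⟨bi, be⟩ := bmin_integral h0 h1 hβ0
  have hfb : ∀ t ∈ Ioi (0:ℝ), ‖f t‖ ≤ t ^ (γ - 1) * min 1 (‖β‖ / t) := by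
    intro t ht
    have hk : 0 ≤ t ^ (γ - 1) := Real.rpow_nonneg (le_of_lt ht) _
    rw [hf]
    simp only
    rw [norm_smul, Real.norm_of_nonneg hk]
    gcongr
    exact symb_bound ht hβ
  have hfc : ContinuousOn f (Ioi 0) := by
    refine (kpow_continuousOn γ).smul (continuousOn_const.div (by fun_prop) ?_)
    intro t ht h3
    have := (abs_add_ge ht hβ).1
    rw [h3, norm_zero] at this
    exact absurd ht (not_lt.2 this)
  have hfi : IntegrableOn f (Ioi 0) := by
    refine Integrable.mono' bi (hfc.aestronglyMeasurable measurableSet_Ioi) ?_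
    exact (ae_restrict_iff' measurableSet_Ioi).2 (Eventually.of_forall hfb)
  set F : ℂ := ∫ t in Ioi (0:ℝ), f t with hF
  have hF1 : ‖F‖ ≤ ‖β‖ ^ γ * E := by
    rw [← be]
    exact norm_integral_le_of_norm_le bi
      ((ae_restrict_iff' measurableSet_Ioi).2 (Eventually.of_forall hfb))
  have hF2 : ‖β‖ ^ γ * (1 / (4 * γ)) ≤ ‖F‖ := by
    refine le_trans ?_ (Complex.re_le_norm F)
    have e1 : F.re = ∫ t in Ioi (0:ℝ), (f t).re := by
      rw [hF]; exact (integral_re hfi).symm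
    have hre : ∀ t ∈ Ioi (0:ℝ), (f t).re = t ^ (γ - 1) * (β / (t + β)).re := by
      intro t ht
      simp [hf]
    have e2 : ∫ t in Ioc (0:ℝ) ‖β‖, t ^ (γ - 1) * (1 / 4) = ‖β‖ ^ γ * (1 / (4 * γ)) := by
      rw [integral_mul_const, ← intervalIntegral.integral_of_le hβ0.le,
        integral_rpow (Or.inl (by linarith)), sub_add_cancel, Real.zero_rpow h0.ne']
      field_simp
      ring
    have hrei : IntegrableOn (fun t => (f t).re) (Ioi 0) := hfi.re
    rw [e1, ← e2]
    calc _ ≤ ∫ t in Ioc (0:ℝ) ‖β‖, (f t).re := by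
          refine setIntegral_mono_on ?_ (hrei.mono_set Ioc_subset_Ioi_self) measurableSet_Ioc ?_
          · refine Integrable.mul_const ?_ _
            have := intervalIntegral.intervalIntegrable_rpow' (a := 0) (b := ‖β‖)
              (r := γ - 1) (by linarith)
            exact (intervalIntegrable_iff_integrableOn_Ioc_of_le hβ0.le).1 this
          · intro t ht
            rw [hre t ht.1]
            have hk : 0 ≤ t ^ (γ - 1) := Real.rpow_nonneg ht.1.le _
            gcongr
            exact (symb_re ht.1 hβ).2 ht.2
      _ ≤ _ := by
          refine setIntegral_mono_set hrei ?_ (HasSubset.Subset.eventuallyLE Ioc_subset_Ioi_self)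
          refine (ae_restrict_iff' measurableSet_Ioi).2 (Eventually.of_forall fun t ht => ?_)
          change 0 ≤ (f t).re
          rw [hre t ht]
          exact mul_nonneg (Real.rpow_nonneg (le_of_lt ht) _) (symb_re ht hβ).1
  have hbp : 0 ≤ ‖β‖ ^ γ := by positivity
  have hbp1 : ‖β‖ ^ γ ≤ 1 := Real.rpow_le_one hβ0.le hβ1 h0.le
  have hgn : ‖c0 • F‖ = c0 * ‖F‖ := by rw [norm_smul, Real.norm_of_nonneg hc.le]
  refine ⟨c0 • F, ?_, ?_, ?_⟩
  · rw [hgn, mul_assoc]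
    gcongr
    linarith
  · rw [hgn]
    have : 0 ≤ c0 * (D * E) * ‖β‖ ^ γ := by positivity
    nlinarith
  · set G := ∫ t in Ioi (0:ℝ), (t ^ (γ - 1) : ℝ) • (B * Sinv B t) with hG
    have hbal : balakrishnan B γ = c0 • G := rfl
    have eG : B (G x) = ∫ t in Ioi (0:ℝ), (t ^ (γ - 1) : ℝ) • B ((B * Sinv B t) x) := by
      rw [hG, ContinuousLinearMap.integral_apply hi, ← ContinuousLinearMap.integral_comp_comm]
      · refine integral_congr_ae (Eventually.of_forall fun t => ?_)
        simp only [ContinuousLinearMap.smul_apply, ContinuousLinearMap.map_smul_of_tower]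
      · exact hi.apply_continuousLinearMap x
    have hi2 : IntegrableOn (fun t : ℝ => (t ^ (γ - 1) : ℝ) • B ((B * Sinv B t) x)) (Ioi 0) := by
      have := B.integrable_comp (hi.apply_continuousLinearMap x)
      refine this.congr (Eventually.of_forall fun t => ?_)
      simp only [ContinuousLinearMap.smul_apply, ContinuousLinearMap.map_smul_of_tower]
    have eF : F • B x = ∫ t in Ioi (0:ℝ), f t • B x := (integral_smul_const f (B x)).symm
    have hdiff : ‖B (G x) - F • B x‖ ≤ D * E * ‖w‖ := by
      rw [eG, eF, ← integral_sub hi2 (hfi.smul_const _)]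
      obtain ⟨ci, ce⟩ := bmin_integral h0 h1 one_pos
      have e3 : D * E * ‖w‖ = ∫ t in Ioi (0:ℝ), D * (t ^ (γ - 1) * min 1 (1 / t)) * ‖w‖ := by
        rw [integral_mul_const, integral_const_mul, ce, Real.one_rpow, one_mul]
      rw [e3]
      refine norm_integral_le_of_norm_le ((ci.const_mul D).mul_const _)
        ((ae_restrict_iff' measurableSet_Ioi).2 (Eventually.of_forall fun t ht => ?_))
      have ht' : 0 < t := ht
      have e4 : (t ^ (γ - 1) : ℝ) • B ((B * Sinv B t) x) - f t • B x =
          ((t : ℂ) / (t + β)) • ((t ^ (γ - 1) : ℝ) • (B * Sinv B t)) w := by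
        rw [h.symb ht' hβ hx, map_add, map_smul, map_smul, smul_add, hf]
        simp only [ContinuousLinearMap.smul_apply, ContinuousLinearMap.mul_apply]
        rw [smul_assoc, add_sub_cancel_left, smul_comm]
      rw [e4, norm_smul]
      have h5 : ‖(t : ℂ) / (t + β)‖ ≤ 1 := by
        have h6 := (abs_add_ge ht' hβ).1
        rw [norm_div, Complex.norm_real, Real.norm_of_nonneg ht'.le]
        exact (div_le_one (ht'.trans_le h6)).2 h6
      have h7 := ContinuousLinearMap.le_of_opNorm_le _ (h.integrand_bound γ ht') w
      calc _ ≤ 1 * (D * (t ^ (γ - 1) * min 1 (1 / t)) * ‖w‖) := by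
            gcongr
        _ = _ := one_mul _
    have e5 : (B * balakrishnan B γ) x - (c0 • F * β) • x =
        c0 • (B (G x) - F • B x) + (c0 • F) • w := by
      rw [hbal, ContinuousLinearMap.mul_apply, ContinuousLinearMap.smul_apply,
        ContinuousLinearMap.map_smul_of_tower, hx]
      generalize B (G x) = z
      rw [← Complex.coe_smul, ← Complex.coe_smul, ← Complex.coe_smul, smul_eq_mul]
      module
    rw [e5]
    refine (norm_add_le _ _).trans ?_
    rw [norm_smul, norm_smul, hgn, Real.norm_of_nonneg hc.le]
    have h8 : c0 * ‖F‖ ≤ c0 * E := by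
      gcongr
      nlinarith
    calc _ ≤ c0 * (D * E * ‖w‖) + (c0 * E) * ‖w‖ := by gcongr
      _ = _ := by ring

theorem frac_bounds {α : ℝ} (h0 : 0 ≤ α) (hne : α ≠ (⌊α⌋₊ : ℝ)) : 0 < α - ⌊α⌋₊ ∧ α - ⌊α⌋₊ < 1 := by
  have h1 := Nat.floor_le h0
  have h2 := Nat.lt_floor_add_one α
  refine ⟨?_, by linarith⟩
  rcases h1.lt_or_eq with h | h
  · linarith
  · exact absurd h.symm hne

theorem Sectl.opPow_commute (h : Sectl B M) {α : ℝ} (hα : 1 ≤ α)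
    {L : X →L[ℂ] X} (hL : Commute L B) : Commute L (opPow B α) := by
  unfold opPow
  split_ifs with hne
  · exact hL.pow_right _
  · obtain ⟨a, b⟩ := frac_bounds (by linarith) hne
    exact (hL.pow_right _).mul_right (h.bal_commute a b hL)

theorem Sectl.symb_opPow (h : Sectl B M) {α : ℝ} (hα : 1 ≤ α) :
    ∃ C c : ℝ, 0 ≤ C ∧ 0 < c ∧ ∀ (β : ℂ) (x w : X), 0 ≤ β.re → 0 < ‖β‖ → ‖β‖ ≤ 1 →
      B x = β • x + w → ∃ g : ℂ, c * ‖β‖ ^ α ≤ ‖g‖ ∧ ‖g‖ ≤ C * ‖β‖ ^ α ∧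
        ‖opPow B α x - g • x‖ ≤ C * ‖w‖ := by
  by_cases hne : α = (⌊α⌋₊ : ℝ)
  · have e : opPow B α = B ^ ⌊α⌋₊ := by unfold opPow; rw [if_pos hne]
    obtain ⟨C, hC, hh⟩ := symb_pow B ⌊α⌋₊
    refine ⟨C + 1, 1, by positivity, one_pos, fun β x w hβ hβ0 hβ1 hx => ⟨β ^ ⌊α⌋₊, ?_, ?_, ?_⟩⟩
    · rw [norm_pow, ← Real.rpow_natCast, ← hne, one_mul]
    · rw [norm_pow, ← Real.rpow_natCast, ← hne]
      have : 0 ≤ ‖β‖ ^ α := by positivity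
      nlinarith
    · rw [e]
      refine (hh β x w hβ1 hx).trans ?_
      gcongr; linarith
  · obtain ⟨a, b⟩ := frac_bounds (by linarith) hne
    obtain ⟨k, hk⟩ : ∃ k, ⌊α⌋₊ = k + 1 := by
      have : 1 ≤ ⌊α⌋₊ := Nat.le_floor (by simpa using hα)
      exact ⟨⌊α⌋₊ - 1, by omega⟩
    set γ := α - ⌊α⌋₊ with hγ
    have hαk : α = γ + k + 1 := by rw [hγ, hk]; push_cast; ring
    have e : opPow B α = (B * balakrishnan B γ) * B ^ k := by
      unfold opPow
      rw [if_neg hne, ← hγ, hk, pow_succ', mul_assoc B, mul_assoc B]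
      congr 1
      exact ((h.bal_commute a b (Commute.refl B)).pow_left k).eq
    obtain ⟨C, hC, hh⟩ := symb_pow B k
    obtain ⟨C', c, hC', hc, hh'⟩ := h.symb_bal a b
    set N := ‖B * balakrishnan B γ‖ with hN
    refine ⟨C' + N * C, c, by positivity, hc, fun β x w hβ hβ0 hβ1 hx => ?_⟩
    obtain ⟨g, g1, g2, g3⟩ := hh' β x w hβ hβ0 hβ1 hx
    have h1 := hh β x w hβ1 hx
    have eα : ‖β‖ ^ α = ‖β‖ ^ γ * ‖β‖ ^ (k + 1) := by
      rw [hαk, add_assoc, Real.rpow_add hβ0, ← Nat.cast_one, ← Nat.cast_add, Real.rpow_natCast]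
    have en : ‖g * β ^ (k + 1)‖ = ‖g‖ * ‖β‖ ^ (k + 1) := by rw [norm_mul, norm_pow]
    have hbk : 0 ≤ ‖β‖ ^ (k + 1) := by positivity
    refine ⟨g * β ^ (k + 1), ?_, ?_, ?_⟩
    · rw [en, eα, ← mul_assoc]; gcongr
    · rw [en, eα, ← mul_assoc]
      gcongr
      refine g2.trans ?_
      gcongr
      have : 0 ≤ N * C := by positivity
      linarith
    · rw [e, ContinuousLinearMap.mul_apply]
      have e6 : (B * balakrishnan B γ) ((B ^ k) x) - (g * β ^ (k + 1)) • x =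
        (B * balakrishnan B γ) ((B ^ k) x - β ^ k • x) +
          β ^ k • ((B * balakrishnan B γ) x - (g * β) • x) := by
        rw [map_sub, map_smul, pow_succ]
        module
      rw [e6]
      refine (norm_add_le _ _).trans ?_
      rw [norm_smul, norm_pow]
      have h2 := (B * balakrishnan B γ).le_opNorm ((B ^ k) x - β ^ k • x)
      have h3 : ‖β‖ ^ k ≤ 1 := pow_le_one₀ hβ0.le hβ1
      calc _ ≤ N * (C * ‖w‖) + 1 * (C' * ‖w‖) := by
            gcongr
            refine h2.trans ?_
            gcongr
        _ = _ := by ring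
end Bal

open Filter MeasureTheory Set Complex Asymptotics

section App
open scoped Topology

/-- the symbol of `B(A)` at `-is` -/
noncomputable def bet (s : ℝ) : ℂ := -(I * s) / (1 - I * s)

theorem one_sub_bounds (s : ℝ) : 1 ≤ ‖1 - I * (s : ℂ)‖ ∧ |s| ≤ ‖1 - I * (s : ℂ)‖ ∧
    ‖1 - I * (s : ℂ)‖ ≤ 1 + |s| := by
  refine ⟨?_, ?_, ?_⟩
  · have := Complex.abs_re_le_norm (1 - I * (s : ℂ)); simpa using this
  · have := Complex.abs_im_le_norm (1 - I * (s : ℂ)); simpa using this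
  · have := norm_sub_le (1 : ℂ) (I * (s : ℂ)); simpa using this

theorem bet_norm (s : ℝ) : ‖bet s‖ = |s| / ‖1 - I * (s : ℂ)‖ := by
  simp [bet]

theorem bet_re (s : ℝ) : 0 ≤ (bet s).re := by
  rw [bet, Complex.div_re]
  simp
  have := Complex.normSq_nonneg (1 - I * (s : ℂ))
  exact div_nonneg (mul_self_nonneg s) this

theorem bet_bounds {s : ℝ} (hs : s ≠ 0) : 0 < ‖bet s‖ ∧ ‖bet s‖ ≤ 1 ∧ ‖bet s‖ ≤ |s| ∧
    |s| / (1 + |s|) ≤ ‖bet s‖ := by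
  obtain ⟨h1, h2, h3⟩ := one_sub_bounds s
  have h4 : 0 < ‖1 - I * (s : ℂ)‖ := by linarith
  have h5 : 0 < |s| := abs_pos.2 hs
  rw [bet_norm]
  refine ⟨by positivity, (div_le_one h4).2 h2, div_le_self h5.le h1, ?_⟩
  gcongr

variable {X : Type*} [NormedAddCommGroup X] [InnerProductSpace ℂ X] [CompleteSpace X]
  {Tsg : C0Semigroup X} {A : X →ₗ.[ℂ] X} {J : X →L[ℂ] X}

theorem symbol_eq (hJ : IsResolvent A 1 J) {s : ℝ} {R : X →L[ℂ] X}
    (hR : IsResolvent A (Complex.I * (s : ℂ)) R) (y : X) :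
    ∃ w : X, (1 - J : X →L[ℂ] X) (R y) = bet s • R y + w ∧ ‖w‖ ≤ ‖J‖ * ‖y‖ := by
  obtain ⟨h1, h2, h3⟩ := one_sub_bounds s
  have h4 : 1 - I * (s : ℂ) ≠ 0 := by
    intro h; rw [h, norm_zero] at h1; linarith
  refine ⟨(1 - I * (s : ℂ))⁻¹ • J y, ?_, ?_⟩
  · have h5 := resolvent_identity hJ hR y
    have h6 : J (R y) = (1 - I * (s : ℂ))⁻¹ • (R y - J y) := by
      rw [eq_inv_smul_iff₀ h4]; exact eq_sub_of_add_eq' h5.symm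
    rw [ContinuousLinearMap.sub_apply, ContinuousLinearMap.one_apply, h6]
    have e : bet s = 1 - (1 - I * (s : ℂ))⁻¹ := by
      rw [bet]; field_simp; ring
    rw [e]
    module
  · rw [norm_smul, norm_inv]
    have := J.le_opNorm y
    calc _ ≤ 1 * (‖J‖ * ‖y‖) := by
          gcongr
          exact inv_le_one_of_one_le₀ h1
      _ = _ := one_mul _

theorem sectl_B (hgen : IsGenerator Tsg A) {K : ℝ} (hK : ∀ t : ℝ, 0 ≤ t → ‖Tsg.T t‖ ≤ K)
    (hJ : IsResolvent A 1 J) : Sectl (1 - J : X →L[ℂ] X) (1 + K) := by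
  intro t ht
  have hK0 : 0 ≤ K := (norm_nonneg _).trans (hK 0 le_rfl)
  set μ : ℝ := t / (1 + t) with hμ
  have ht1 : 0 < 1 + t := by linarith
  have hμ0 : 0 < μ := by positivity
  obtain ⟨R, hR, -, hRn⟩ := exists_laplace hgen hK (μ : ℂ) (by simpa using hμ0)
  have htc : (1 + (t : ℂ)) ≠ 0 := by exact_mod_cast ht1.ne'
  have hν : (1 - (μ : ℂ)) = (1 + (t : ℂ))⁻¹ := by
    rw [hμ]; push_cast; field_simp; ring
  have hid : ∀ x, R x = J x + (1 + (t : ℂ))⁻¹ • J (R x) := by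
    intro x; rw [← hν]; exact resolvent_identity hJ hR x
  have hcm : ∀ x, J (R x) = R (J x) := resolvent_comm hJ hR
  set U : X →L[ℂ] X := (t : ℂ) • (1 : X →L[ℂ] X) + (1 - J) with hU
  set V : X →L[ℂ] X := (1 + (t : ℂ))⁻¹ • (1 + (1 + (t : ℂ))⁻¹ • R) with hV
  have hUV : U * V = 1 := by
    ext x
    simp only [hU, hV, ContinuousLinearMap.mul_apply, ContinuousLinearMap.add_apply,
      ContinuousLinearMap.sub_apply, ContinuousLinearMap.smul_apply,
      ContinuousLinearMap.one_apply, map_add, map_smul]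
    have h1 := hid x
    set a := R x
    have h2 : (1 + (t : ℂ))⁻¹ • J a = a - J x := eq_sub_of_add_eq' h1.symm
    have h4 : a = (1 + (t : ℂ))⁻¹ • (a + (t : ℂ) • a) := by
      rw [eq_inv_smul_iff₀ htc]; module
    have h5 : (1 + (t : ℂ))⁻¹ • ((t : ℂ) • a + (a - J a)) = J x := by
      calc _ = (1 + (t : ℂ))⁻¹ • (a + (t : ℂ) • a) - (1 + (t : ℂ))⁻¹ • J a := by module
        _ = J x := by rw [← h4, h2]; abel
    rw [h5, inv_smul_eq_iff₀ htc]
    module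
  have hcom : Commute V U := by
    have hJR : Commute R J := by
      ext x; exact (hcm x).symm
    have h1 : Commute R U := by
      rw [hU]
      exact ((Commute.one_right R).smul_right _).add_right ((Commute.one_right R).sub_right hJR)
    rw [hV]
    exact (((Commute.one_left U).add_left (h1.smul_left _))).smul_left _
  have hVU : V * U = 1 := by rw [hcom.eq, hUV]
  let u : (X →L[ℂ] X)ˣ := ⟨U, V, hUV, hVU⟩
  refine ⟨⟨u, rfl⟩, ?_⟩
  have : Ring.inverse U = V := Ring.inverse_unit u
  rw [this, hV, norm_smul, norm_inv]
  have e1 : ‖(1 + (t : ℂ))‖ = 1 + t := by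
    rw [show (1 + (t : ℂ)) = ((1 + t : ℝ) : ℂ) by push_cast; rfl, Complex.norm_real,
      Real.norm_of_nonneg ht1.le]
  have e2 : ‖(1 : X →L[ℂ] X) + (1 + (t : ℂ))⁻¹ • R‖ ≤ 1 + K / t := by
    refine (norm_add_le _ _).trans (add_le_add ContinuousLinearMap.norm_id_le ?_)
    rw [norm_smul, norm_inv, e1]
    have : (μ : ℂ).re = μ := Complex.ofReal_re _
    rw [this] at hRn
    calc _ ≤ (1 + t)⁻¹ * (K / μ) := by gcongr
      _ = K / t := by rw [hμ]; field_simp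
  rw [e1]
  calc _ ≤ (1 + t)⁻¹ * (1 + K / t) := by gcongr
    _ ≤ (1 + K) / t := by
      rw [inv_mul_eq_div, div_le_div_iff₀ ht1 ht]
      field_simp
      nlinarith [mul_nonneg hK0 ht.le]

theorem T_commute_B (hgen : IsGenerator Tsg A) (hJ : IsResolvent A 1 J) {t : ℝ} (ht : 0 ≤ t) :
    Commute (Tsg.T t) (1 - J) := by
  refine (Commute.one_right _).sub_right ?_
  ext x; exact (resolvent_T_comm hgen hJ ht x).symm

theorem Res_commute_B (hJ : IsResolvent A 1 J) {lam : ℂ} {R : X →L[ℂ] X}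
    (hR : IsResolvent A lam R) : Commute R (1 - J) := by
  refine (Commute.one_right _).sub_right ?_
  ext x; exact (resolvent_comm hJ hR x).symm

theorem res_middle {Res : ℝ → X →L[ℂ] X}
    (hRes : ∀ s : ℝ, s ≠ 0 → IsResolvent A (Complex.I * (s : ℂ)) (Res s)) {δ S : ℝ} (hδ : 0 < δ) :
    ∃ C : ℝ, ∀ s : ℝ, δ ≤ |s| → |s| ≤ S → ‖Res s‖ ≤ C := by
  have hk : IsCompact ({s : ℝ | δ ≤ |s|} ∩ Icc (-S) S) :=
    (isCompact_Icc).inter_left (isClosed_le continuous_const continuous_abs)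
  suffices h : ∃ C : ℝ, ∀ s ∈ {s : ℝ | δ ≤ |s|} ∩ Icc (-S) S, s ≠ 0 → ‖Res s‖ ≤ C by
    obtain ⟨C, hC⟩ := h
    refine ⟨C, fun s h1 h2 => hC s ⟨h1, abs_le.1 h2⟩ ?_⟩
    intro h0; rw [h0, abs_zero] at h1; linarith
  refine hk.induction_on (p := fun U => ∃ C : ℝ, ∀ s ∈ U, s ≠ 0 → ‖Res s‖ ≤ C)
    ⟨0, by simp⟩ ?_ ?_ ?_
  · rintro s t hst ⟨C, hC⟩
    exact ⟨C, fun x hx => hC x (hst hx)⟩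
  · rintro s t ⟨C, hC⟩ ⟨D, hD⟩
    refine ⟨max C D, ?_⟩
    rintro x (hx | hx) h0
    · exact (hC x hx h0).trans (le_max_left _ _)
    · exact (hD x hx h0).trans (le_max_right _ _)
  · rintro s0 ⟨hs0, -⟩
    have hs0' : s0 ≠ 0 := by
      intro h0; rw [h0] at hs0; simp at hs0; linarith
    set r := ‖Res s0‖ with hr
    have hr0 : 0 ≤ r := norm_nonneg _
    refine ⟨Metric.ball s0 (1 / (2 * (r + 1))),
      mem_nhdsWithin_of_mem_nhds (Metric.ball_mem_nhds _ (by positivity)), 2 * r, ?_⟩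
    intro s hs hs'
    rw [Metric.mem_ball, Real.dist_eq, abs_sub_comm] at hs
    have e : Res s = Res s0 + (I * (s0 : ℂ) - I * (s : ℂ)) • (Res s0 * Res s) := by
      ext x
      exact resolvent_identity (hRes s0 hs0') (hRes s hs') x
    have e1 : ‖I * (s0 : ℂ) - I * (s : ℂ)‖ = |s0 - s| := by
      rw [← mul_sub, norm_mul, norm_I, one_mul, ← Complex.ofReal_sub, Complex.norm_real,
        Real.norm_eq_abs]
    have h1 : ‖Res s‖ ≤ r + |s0 - s| * (r * ‖Res s‖) := by
      calc ‖Res s‖ = ‖Res s0 + (I * (s0 : ℂ) - I * (s : ℂ)) • (Res s0 * Res s)‖ := by rw [← e]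
        _ ≤ _ := by
          refine (norm_add_le _ _).trans ?_
          rw [norm_smul, e1]
          gcongr
          exact norm_mul_le _ _
    have h2 : |s0 - s| * r ≤ 1 / 2 := by
      calc _ ≤ 1 / (2 * (r + 1)) * (r + 1) := by gcongr; linarith
        _ = 1 / 2 := by field_simp
    have h3 := mul_le_mul_of_nonneg_right h2 (norm_nonneg (Res s))
    linarith

theorem cond_iff {Res : ℝ → X →L[ℂ] X}
    (hRes : ∀ s : ℝ, s ≠ 0 → IsResolvent A (Complex.I * (s : ℂ)) (Res s)) {α : ℝ} (hα : 1 ≤ α) :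
    ((∃ C > (0 : ℝ), ∃ δ > (0 : ℝ), ∀ s : ℝ, 0 < |s| → |s| ≤ δ → ‖Res s‖ ≤ C * |s| ^ (-α)) ∧
        ∃ C S : ℝ, ∀ s : ℝ, S ≤ |s| → ‖Res s‖ ≤ C) ↔
    ∃ C : ℝ, 0 ≤ C ∧ ∀ s : ℝ, s ≠ 0 → ‖Res s‖ ≤ C * ‖bet s‖ ^ (-α) := by
  constructor
  · rintro ⟨⟨C1, hC1, δ, hδ, h1⟩, C2, S, h2⟩
    obtain ⟨C3, h3⟩ := res_middle hRes (S := S) hδ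
    refine ⟨C1 + |C2| + |C3|, by positivity, fun s hs => ?_⟩
    obtain ⟨b0, b1, b2, b3⟩ := bet_bounds hs
    have hs0 : 0 < |s| := abs_pos.2 hs
    have hb : 1 ≤ ‖bet s‖ ^ (-α) := Real.one_le_rpow_of_pos_of_le_one_of_nonpos b0 b1 (by linarith)
    have a2 := abs_nonneg C2
    have a3 := abs_nonneg C3
    rcases le_total |s| δ with h | h
    · have h4 : |s| ^ (-α) ≤ ‖bet s‖ ^ (-α) := Real.rpow_le_rpow_of_nonpos b0 b2 (by linarith)
      refine (h1 s hs0 h).trans ?_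
      have : 0 ≤ |s| ^ (-α) := by positivity
      nlinarith
    · rcases le_total |s| S with h' | h'
      · refine (h3 s h h').trans ?_
        have := le_abs_self C3
        nlinarith
      · refine (h2 s h').trans ?_
        have := le_abs_self C2
        nlinarith
  · rintro ⟨C, hC, h⟩
    have h2 : (2:ℝ) ^ (-α) > 0 := by positivity
    constructor
    · refine ⟨C * 2 ^ α + 1, by positivity, 1, one_pos, fun s hs hs1 => ?_⟩
      obtain ⟨b0, b1, b2, b3⟩ := bet_bounds (abs_pos.1 hs)
      refine (h s (abs_pos.1 hs)).trans ?_
      have h3 : |s| / 2 ≤ ‖bet s‖ := by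
        refine le_trans ?_ b3
        gcongr; linarith
      have h4 : ‖bet s‖ ^ (-α) ≤ (|s| / 2) ^ (-α) :=
        Real.rpow_le_rpow_of_nonpos (by positivity) h3 (by linarith)
      have h5 : (|s| / 2) ^ (-α) = |s| ^ (-α) * 2 ^ α := by
        rw [Real.div_rpow hs.le (by norm_num), Real.rpow_neg (by norm_num : (0:ℝ) ≤ 2), div_inv_eq_mul]
      have h6 : 0 ≤ |s| ^ (-α) := by positivity
      calc _ ≤ C * (|s| ^ (-α) * 2 ^ α) := by rw [← h5]; gcongr
        _ ≤ _ := by nlinarith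
    · refine ⟨C * (1 / 2 : ℝ) ^ (-α), 1, fun s hs => ?_⟩
      have hs0 : s ≠ 0 := by
        intro h0; rw [h0, abs_zero] at hs; linarith
      obtain ⟨b0, b1, b2, b3⟩ := bet_bounds hs0
      refine (h s hs0).trans ?_
      have h3 : 1 / 2 ≤ ‖bet s‖ := by
        refine le_trans ?_ b3
        rw [div_le_div_iff₀ (by norm_num) (by positivity)]
        linarith
      have h4 : ‖bet s‖ ^ (-α) ≤ (1 / 2) ^ (-α) :=
        Real.rpow_le_rpow_of_nonpos (by positivity) h3 (by linarith)
      gcongr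

theorem imp_ii (hgen : IsGenerator Tsg A) {K : ℝ} (hK : ∀ t : ℝ, 0 ≤ t → ‖Tsg.T t‖ ≤ K)
    {Res : ℝ → X →L[ℂ] X}
    (hRes : ∀ s : ℝ, s ≠ 0 → IsResolvent A (Complex.I * (s : ℂ)) (Res s))
    (hJ : IsResolvent A 1 J) {α : ℝ} (hα : 1 ≤ α)
    (h : ∃ C : ℝ, 0 ≤ C ∧ ∀ s : ℝ, s ≠ 0 → ‖Res s‖ ≤ C * ‖bet s‖ ^ (-α)) :
    (fun t : ℝ => ‖Tsg.T t ∘L opPow ((1 : X →L[ℂ] X) - J) α‖) =O[atTop] fun t : ℝ => t⁻¹ := by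
  obtain ⟨CR, hCR, hR⟩ := h
  have hB := sectl_B hgen hK hJ
  obtain ⟨C, c, hC, hc, hsym⟩ := hB.symb_opPow hα
  set Y := opPow ((1 : X →L[ℂ] X) - J) α with hYdef
  have hM : ∀ s : ℝ, s ≠ 0 → ‖Res s ∘L Y‖ ≤ C * CR + C * ‖J‖ := by
    intro s hs
    refine ContinuousLinearMap.opNorm_le_bound _ (by positivity) fun y => ?_
    have hcomm := (hB.opPow_commute hα (Res_commute_B hJ (hRes s hs))).eq
    have e1 : (Res s ∘L Y) y = Y (Res s y) := congrArg (fun L => L y) hcomm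
    rw [e1]
    obtain ⟨w, hw, hwn⟩ := symbol_eq hJ (hRes s hs) y
    obtain ⟨b0, b1, b2, b3⟩ := bet_bounds hs
    obtain ⟨g, g1, g2, g3⟩ := hsym (bet s) (Res s y) w (bet_re s) b0 b1 hw
    have h1 := (Res s).le_of_opNorm_le (hR s hs) y
    have h2 : ‖bet s‖ ^ α * ‖bet s‖ ^ (-α) = 1 := by
      rw [← Real.rpow_add b0, add_neg_cancel, Real.rpow_zero]
    calc ‖Y (Res s y)‖ = ‖g • Res s y + (Y (Res s y) - g • Res s y)‖ := by congr 1; abel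
      _ ≤ ‖g‖ * ‖Res s y‖ + ‖Y (Res s y) - g • Res s y‖ := by
          rw [← norm_smul]; exact norm_add_le _ _
      _ ≤ (C * ‖bet s‖ ^ α) * (CR * ‖bet s‖ ^ (-α) * ‖y‖) + C * (‖J‖ * ‖y‖) := by
          gcongr
          exact g3.trans (by gcongr)
      _ = (C * CR * (‖bet s‖ ^ α * ‖bet s‖ ^ (-α)) + C * ‖J‖) * ‖y‖ := by ring
      _ = _ := by rw [h2, mul_one]
  have hYT : ∀ t : ℝ, 0 ≤ t → ∀ x, Y (Tsg.T t x) = Tsg.T t (Y x) := by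
    intro t ht x
    exact (congrArg (fun L => L x) (hB.opPow_commute hα (T_commute_B hgen hJ ht)).eq).symm
  refine IsBigO.of_bound ((2 * Real.exp 1 * K ^ 2 * (1 + K)) * (C * CR + C * ‖J‖)) ?_
  filter_upwards [eventually_gt_atTop 0] with t ht
  have := decay_of_bound hgen hK hRes hYT hM ht
  rw [norm_norm, Real.norm_of_nonneg (by positivity), ← div_eq_mul_inv]
  exact this

theorem scalar_est {b ε α q : ℝ} {m : ℕ} (hb : 0 < b) (hε : 0 < ε) (hα : 1 ≤ α)
    (hm : α - 1 ≤ m) (hq0 : 0 ≤ q) (hq : q ≤ min 1 (b / ε)) :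
    b * q ^ m * b ^ (-α) ≤ ε ^ (1 - α) := by
  have h1 : q ^ m ≤ (b / ε) ^ (α - 1) := by
    have hmin : 0 < min 1 (b / ε) := lt_min one_pos (by positivity)
    calc q ^ m ≤ (min 1 (b / ε)) ^ m := pow_le_pow_left₀ hq0 hq m
      _ = (min 1 (b / ε)) ^ (m : ℝ) := (Real.rpow_natCast _ _).symm
      _ ≤ (min 1 (b / ε)) ^ (α - 1) :=
          Real.rpow_le_rpow_of_exponent_ge hmin (min_le_left _ _) hm
      _ ≤ _ := Real.rpow_le_rpow hmin.le (min_le_right _ _) (by linarith)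
  calc _ ≤ b * (b / ε) ^ (α - 1) * b ^ (-α) := by gcongr
    _ = ε ^ (1 - α) * (b ^ (1:ℝ) * b ^ (α - 1) * b ^ (-α)) := by
        rw [Real.div_rpow hb.le hε.le, show 1 - α = -(α - 1) by ring, Real.rpow_neg hε.le,
          Real.rpow_one]
        field_simp
    _ = _ := by
        rw [← Real.rpow_add hb, ← Real.rpow_add hb,
          show 1 + (α - 1) + -α = 0 by ring, Real.rpow_zero, mul_one]

theorem imp_iii (hgen : IsGenerator Tsg A) {K : ℝ} (hK : ∀ t : ℝ, 0 ≤ t → ‖Tsg.T t‖ ≤ K)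
    {Res : ℝ → X →L[ℂ] X}
    (hRes : ∀ s : ℝ, s ≠ 0 → IsResolvent A (Complex.I * (s : ℂ)) (Res s))
    (hJ : IsResolvent A 1 J) {α : ℝ} (hα : 1 ≤ α)
    (h : ∃ C : ℝ, 0 ≤ C ∧ ∀ s : ℝ, s ≠ 0 → ‖Res s‖ ≤ C * ‖bet s‖ ^ (-α)) :
    (fun t : ℝ => ‖Tsg.T t ∘L ((1 : X →L[ℂ] X) - J)‖) =O[atTop]
      fun t : ℝ => t ^ (-(1 / α)) := by
  obtain ⟨CR, hCR, hR⟩ := h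
  have hK0 : 0 ≤ K := (norm_nonneg _).trans (hK 0 le_rfl)
  have hB := sectl_B hgen hK hJ
  set m := ⌈α⌉₊ with hm
  have hmα : α - 1 ≤ m := by
    have := Nat.le_ceil α
    linarith
  obtain ⟨C, hC, hsym⟩ := hB.symb_P m
  obtain ⟨C2, hC2, hone⟩ := hB.one_sub_P m
  set B : X →L[ℂ] X := 1 - J with hBdef
  have hcomY : ∀ ε : ℝ, 0 < ε → ∀ L : X →L[ℂ] X, Commute L B →
      Commute L (B * (B * Sinv B ε) ^ m) := fun ε hε L hL =>
    hL.mul_right ((hL.mul_right (hB.commute hL hε)).pow_right m)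
  have hM : ∀ ε : ℝ, 0 < ε → ε ≤ 1 → ∀ s : ℝ, s ≠ 0 →
      ‖Res s ∘L (B * (B * Sinv B ε) ^ m)‖ ≤ (CR + C * ‖J‖) * ε ^ (1 - α) := by
    intro ε hε hε1 s hs
    refine ContinuousLinearMap.opNorm_le_bound _ (by positivity) fun y => ?_
    have hcomm := (hcomY ε hε _ (Res_commute_B hJ (hRes s hs))).eq
    set Y := B * (B * Sinv B ε) ^ m with hY
    have e1 : (Res s ∘L Y) y = Y (Res s y) := congrArg (fun L => L y) hcomm
    rw [e1]
    obtain ⟨w, hw, hwn⟩ := symbol_eq hJ (hRes s hs) y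
    obtain ⟨b0, b1, b2, b3⟩ := bet_bounds hs
    have g3 := hsym ε (bet s) (Res s y) w hε (bet_re s) hw
    set p := bet s / (ε + bet s) with hp
    have hq : ‖p‖ ≤ min 1 (‖bet s‖ / ε) := symb_bound hε (bet_re s)
    have h1 := (Res s).le_of_opNorm_le (hR s hs) y
    have h2 := scalar_est b0 hε hα hmα (norm_nonneg p) hq
    have h3 : 1 ≤ ε ^ (1 - α) :=
      Real.one_le_rpow_of_pos_of_le_one_of_nonpos hε hε1 (by linarith)
    set g := bet s * p ^ m with hg
    have hgn : ‖g‖ = ‖bet s‖ * ‖p‖ ^ m := by rw [hg, norm_mul, norm_pow]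
    calc ‖Y (Res s y)‖ = ‖g • Res s y + (Y (Res s y) - g • Res s y)‖ := by congr 1; abel
      _ ≤ ‖g‖ * ‖Res s y‖ + ‖Y (Res s y) - g • Res s y‖ := by
          rw [← norm_smul]; exact norm_add_le _ _
      _ ≤ ‖g‖ * (CR * ‖bet s‖ ^ (-α) * ‖y‖) + C * (‖J‖ * ‖y‖) := by
          gcongr
          exact g3.trans (by gcongr)
      _ = (CR * (‖bet s‖ * ‖p‖ ^ m * ‖bet s‖ ^ (-α)) + C * ‖J‖ * 1) * ‖y‖ := by rw [hgn]; ring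
      _ ≤ (CR * ε ^ (1 - α) + C * ‖J‖ * ε ^ (1 - α)) * ‖y‖ := by gcongr
      _ = _ := by ring
  set Q := (2 * Real.exp 1 * K ^ 2 * (1 + K)) with hQ
  refine IsBigO.of_bound (Q * (CR + C * ‖J‖) + K * C2) ?_
  filter_upwards [eventually_ge_atTop 1] with t ht
  have ht0 : 0 < t := by linarith
  have hα0 : 0 < α := by linarith
  set ε := t ^ (-(1 / α)) with hεdef
  have hε : 0 < ε := by positivity
  have hε1 : ε ≤ 1 := Real.rpow_le_one_of_one_le_of_nonpos ht (by
    have : 0 ≤ 1 / α := by positivity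
    linarith)
  have hYT : ∀ t : ℝ, 0 ≤ t → ∀ x, (B * (B * Sinv B ε) ^ m) (Tsg.T t x) =
      Tsg.T t ((B * (B * Sinv B ε) ^ m) x) := by
    intro t ht x
    exact (congrArg (fun L => L x) (hcomY ε hε _ (T_commute_B hgen hJ ht)).eq).symm
  have hd := decay_of_bound hgen hK hRes hYT (hM ε hε hε1) ht0
  have h1 := hone ε hε
  have h2 := hK t ht0.le
  have h3 : ε ^ (1 - α) / t = ε := by
    rw [hεdef, ← Real.rpow_mul ht0.le, ← Real.rpow_sub_one ht0.ne']
    congr 1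
    field_simp
    ring
  rw [norm_norm, Real.norm_of_nonneg hε.le]
  set Y := B * (B * Sinv B ε) ^ m with hY
  calc ‖Tsg.T t ∘L B‖ = ‖Tsg.T t ∘L Y + Tsg.T t ∘L (B - Y)‖ := by
        rw [← ContinuousLinearMap.comp_add, add_sub_cancel]
    _ ≤ Q * ((CR + C * ‖J‖) * ε ^ (1 - α)) / t + K * (C2 * ε) := by
        refine (norm_add_le _ _).trans (add_le_add hd ?_)
        refine (ContinuousLinearMap.opNorm_comp_le _ _).trans ?_
        gcongr
    _ = Q * (CR + C * ‖J‖) * (ε ^ (1 - α) / t) + K * C2 * ε := by ring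
    _ = _ := by rw [h3]; ring

theorem converse (hgen : IsGenerator Tsg A) {K : ℝ} (hK : ∀ t : ℝ, 0 ≤ t → ‖Tsg.T t‖ ≤ K)
    {Res : ℝ → X →L[ℂ] X}
    (hRes : ∀ s : ℝ, s ≠ 0 → IsResolvent A (Complex.I * (s : ℂ)) (Res s))
    (hJ : IsResolvent A 1 J) {α p : ℝ} (hp : 0 < p) (hpα : p ≤ α) {Z : X →L[ℂ] X} {C c : ℝ}
    (hC : 0 ≤ C) (hc : 0 < c)
    (hsym : ∀ (β : ℂ) (x w : X), 0 ≤ β.re → 0 < ‖β‖ → ‖β‖ ≤ 1 →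
      (1 - J : X →L[ℂ] X) x = β • x + w → ∃ g : ℂ, c * ‖β‖ ^ p ≤ ‖g‖ ∧
        ‖Z x - g • x‖ ≤ C * ‖w‖)
    (hdec : (fun t : ℝ => ‖Tsg.T t ∘L Z‖) =O[atTop] fun t : ℝ => t ^ (-(p / α))) :
    ∃ C : ℝ, 0 ≤ C ∧ ∀ s : ℝ, s ≠ 0 → ‖Res s‖ ≤ C * ‖bet s‖ ^ (-α) := by
  have hK0 : 0 ≤ K := (norm_nonneg _).trans (hK 0 le_rfl)
  have hα0 : 0 < α := by linarith
  obtain ⟨D, hD0, hD⟩ := hdec.exists_pos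
  rw [IsBigOWith] at hD
  obtain ⟨t0, ht0⟩ := eventually_atTop.1 hD
  have htend : Tendsto (fun t : ℝ => D * t ^ (-(p / α))) atTop (𝓝 (D * 0)) :=
    (tendsto_rpow_neg_atTop (by positivity)).const_mul D
  rw [mul_zero] at htend
  obtain ⟨τ, hτ1, hτ2, hτ3⟩ := ((htend.eventually_le_const (by positivity : 0 < c / 2)).and
    ((eventually_ge_atTop t0).and (eventually_gt_atTop 0))).exists
  refine ⟨2 * (K * C * ‖J‖ / c + K * τ), by positivity, fun s hs => ?_⟩
  refine ContinuousLinearMap.opNorm_le_bound _ (by positivity) fun y => ?_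
  obtain ⟨w, hw, hwn⟩ := symbol_eq hJ (hRes s hs) y
  obtain ⟨b0, b1, b2, b3⟩ := bet_bounds hs
  obtain ⟨g, g1, g2⟩ := hsym (bet s) (Res s y) w (bet_re s) b0 b1 hw
  set b := ‖bet s‖ with hb
  set z := Res s y with hz
  have hbα : 1 ≤ b ^ (-α) := Real.one_le_rpow_of_pos_of_le_one_of_nonpos b0 b1 (by linarith)
  set t := τ * b ^ (-α) with ht
  have htτ : τ ≤ t := le_mul_of_one_le_right hτ3.le hbα
  have htpos : 0 < t := by linarith
  have hTZ := ht0 t (by linarith)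
  rw [norm_norm, Real.norm_of_nonneg (by positivity)] at hTZ
  have e1 : t ^ (-(p / α)) = τ ^ (-(p / α)) * b ^ p := by
    rw [ht, Real.mul_rpow hτ3.le (by positivity), ← Real.rpow_mul b0.le]
    congr 2
    field_simp
  have hlow := lower_bound hgen hK s ⟨z, (hRes s hs).mem_domain y⟩ htpos.le
  have hy := (hRes s hs).eq_apply y
  rw [show (I * (s : ℂ)) • ((⟨z, (hRes s hs).mem_domain y⟩ : A.domain) : X) +
    A ⟨z, (hRes s hs).mem_domain y⟩ = y from hy] at hlow
  change ‖z‖ ≤ ‖Tsg.T t z‖ + K * t * ‖y‖ at hlow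
  have e2 : g • Tsg.T t z = (Tsg.T t ∘L Z) z - Tsg.T t (Z z - g • z) := by
    rw [map_sub, map_smul, ContinuousLinearMap.comp_apply]; abel
  have h1 : c * b ^ p * ‖Tsg.T t z‖ ≤ D * (τ ^ (-(p / α)) * b ^ p) * ‖z‖ + K * (C * (‖J‖ * ‖y‖)) := by
    calc _ ≤ ‖g‖ * ‖Tsg.T t z‖ := by gcongr
      _ = ‖(Tsg.T t ∘L Z) z - Tsg.T t (Z z - g • z)‖ := by rw [← norm_smul, e2]
      _ ≤ ‖(Tsg.T t ∘L Z) z‖ + ‖Tsg.T t (Z z - g • z)‖ := norm_sub_le _ _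
      _ ≤ _ := by
        rw [← e1]
        refine add_le_add (ContinuousLinearMap.le_of_opNorm_le _ hTZ z) ?_
        refine (ContinuousLinearMap.le_of_opNorm_le _ (hK t htpos.le) _).trans ?_
        gcongr
        exact g2.trans (by gcongr)
  have hbp : 0 < b ^ p := by positivity
  have hbpα : b ^ (-p) ≤ b ^ (-α) := Real.rpow_le_rpow_of_exponent_ge b0 b1 (by linarith)
  have hbinv : b ^ p * b ^ (-p) = 1 := by
    rw [← Real.rpow_add b0, add_neg_cancel, Real.rpow_zero]
  have h2 : ‖Tsg.T t z‖ ≤ 1 / 2 * ‖z‖ + K * C * ‖J‖ / c * b ^ (-p) * ‖y‖ := by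
    have h3 : c * b ^ p * ‖Tsg.T t z‖ ≤
        c * b ^ p * (1 / 2 * ‖z‖ + K * C * ‖J‖ / c * b ^ (-p) * ‖y‖) := by
      refine h1.trans ?_
      have e3 : c * b ^ p * (1 / 2 * ‖z‖ + K * C * ‖J‖ / c * b ^ (-p) * ‖y‖) =
        c / 2 * b ^ p * ‖z‖ + (b ^ p * b ^ (-p)) * (K * (C * (‖J‖ * ‖y‖))) := by
        field_simp
      rw [e3, hbinv, one_mul, ← mul_assoc D]
      gcongr
    exact le_of_mul_le_mul_left h3 (by positivity)
  have h4 : K * C * ‖J‖ / c * b ^ (-p) * ‖y‖ ≤ K * C * ‖J‖ / c * b ^ (-α) * ‖y‖ := by gcongr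
  have h5 : K * t * ‖y‖ = K * τ * b ^ (-α) * ‖y‖ := by rw [ht]; ring
  rw [h5] at hlow
  linarith

end App

/-- Let `(T(t))_{t≥0}` be a bounded `C₀`-semigroup on a complex Hilbert
space `X` with generator `−A`, assume `σ(A) ∩ iℝ = {0}`, let `α ≥ 1`, and write
`B(A) = A(I+A)⁻¹ = 1 - J` where `J = (1+A)⁻¹`.  Then the following are equivalent:
(i) `‖(is+A)⁻¹‖ = O(|s|^{-α})` as `s → 0` and `‖(is+A)⁻¹‖ = O(1)` as `|s| → ∞`;
(ii) `‖T(t)B(A)^α‖ = O(t⁻¹)` as `t → ∞`;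
(iii) `‖T(t)B(A)‖ = O(t^{-1/α})` as `t → ∞`. -/
theorem polynomial_decay_singularity_at_zero_tfae
    {X : Type*} [NormedAddCommGroup X] [InnerProductSpace ℂ X] [CompleteSpace X]
    (Tsg : C0Semigroup X) (hbdd : Tsg.Bounded)
    (A : X →ₗ.[ℂ] X) (hgen : IsGenerator Tsg A)
    (h0 : ¬ ∃ R : X →L[ℂ] X, IsResolvent A 0 R)
    (Res : ℝ → X →L[ℂ] X)
    (hRes : ∀ s : ℝ, s ≠ 0 → IsResolvent A (Complex.I * (s : ℂ)) (Res s))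
    (J : X →L[ℂ] X) (hJ : IsResolvent A 1 J)
    (α : ℝ) (hα : 1 ≤ α) :
    (((∃ C > (0 : ℝ), ∃ δ > (0 : ℝ), ∀ s : ℝ, 0 < |s| → |s| ≤ δ →
          ‖Res s‖ ≤ C * |s| ^ (-α)) ∧
        ∃ C S : ℝ, ∀ s : ℝ, S ≤ |s| → ‖Res s‖ ≤ C) ↔
      (fun t : ℝ => ‖Tsg.T t ∘L opPow ((1 : X →L[ℂ] X) - J) α‖) =O[atTop]
        fun t : ℝ => t⁻¹) ∧
    (((fun t : ℝ => ‖Tsg.T t ∘L opPow ((1 : X →L[ℂ] X) - J) α‖) =O[atTop]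
        fun t : ℝ => t⁻¹) ↔
      (fun t : ℝ => ‖Tsg.T t ∘L ((1 : X →L[ℂ] X) - J)‖) =O[atTop]
        fun t : ℝ => t ^ (-(1 / α))) := by
  obtain ⟨K, hK⟩ := hbdd
  have hα0 : 0 < α := by linarith
  have hcond := cond_iff hRes hα
  have hB := sectl_B hgen hK hJ
  have h12 := imp_ii hgen hK hRes hJ hα
  have h13 := imp_iii hgen hK hRes hJ hα
  have h21 : ((fun t : ℝ => ‖Tsg.T t ∘L opPow ((1 : X →L[ℂ] X) - J) α‖) =O[atTop]
        fun t : ℝ => t⁻¹) →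
      ∃ C : ℝ, 0 ≤ C ∧ ∀ s : ℝ, s ≠ 0 → ‖Res s‖ ≤ C * ‖bet s‖ ^ (-α) := by
    intro h
    obtain ⟨C, c, hC, hc, hsym⟩ := hB.symb_opPow hα
    refine converse hgen hK hRes hJ hα0 le_rfl hC hc
      (Z := opPow ((1 : X →L[ℂ] X) - J) α) (fun β x w h1 h2 h3 h4 => ?_) ?_
    · obtain ⟨g, g1, -, g3⟩ := hsym β x w h1 h2 h3 h4
      exact ⟨g, g1, g3⟩
    · have e : (fun t : ℝ => t ^ (-(α / α))) = fun t : ℝ => t⁻¹ := by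
        funext t
        rw [div_self hα0.ne', Real.rpow_neg_one]
      rw [e]
      exact h
  have h31 : ((fun t : ℝ => ‖Tsg.T t ∘L ((1 : X →L[ℂ] X) - J)‖) =O[atTop]
        fun t : ℝ => t ^ (-(1 / α))) →
      ∃ C : ℝ, 0 ≤ C ∧ ∀ s : ℝ, s ≠ 0 → ‖Res s‖ ≤ C * ‖bet s‖ ^ (-α) := by
    intro h
    refine converse hgen hK hRes hJ one_pos hα zero_le_one one_pos
      (Z := (1 : X →L[ℂ] X) - J) (fun β x w h1 h2 h3 h4 => ⟨β, ?_, ?_⟩) h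
    · rw [Real.rpow_one, one_mul]
    · rw [h4, add_sub_cancel_left, one_mul]
  exact ⟨hcond.trans ⟨h12, h21⟩, ⟨fun h => h13 (h21 h), fun h => h12 (h31 h)⟩⟩
end
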